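/- Let $n\geq 3$ and let $Y_n\subset(\mathbb{P}^2)^n$ be the multiview variety of $n$ cameras in general position. Write each factor $\mathbb{P}^2 = \mathbb{C}^2\cup\mathbb{P}^1_\infty$ for a general affine chart, let $H_{\infty,i}\subset(\mathbb{P}^2)^n$ be the divisor with $\mathbb{P}^1_\infty$ in the $i$-th factor, $H_\infty = \bigcup_{i=1}^n H_{\infty,i}$, and $D_\infty = Y_n\cap H_\infty$. Then $\chi(D_\infty) = \frac{n^3}{6} - \frac{3n^2}{2} + \frac{16n}{3}$. -/

import Mathlib

open scoped Manifold Topology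
open Filter

noncomputable section

namespace PaperED

/-! Affine algebraic geometry over ℂ: algebraic subsets of ℂⁿ, genericity,
Zariski tangent spaces, smoothness, and the Euclidean distance degree. -/

/-- "P holds for a general point": P holds on a nonempty Zariski-open subset. -/
def Generically {K : Type} [CommSemiring K] {σ : Type} (P : (σ → K) → Prop) : Prop :=
  ∃ q : MvPolynomial σ K, q ≠ 0 ∧ ∀ a : σ → K, MvPolynomial.eval a q ≠ 0 → P a

/-- Affine algebraic subsets of ℂⁿ (common zero loci of polynomials). -/
def IsAlgSet {n : ℕ} (X : Set (Fin n → ℂ)) : Prop :=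
  ∃ S : Set (MvPolynomial (Fin n) ℂ),
    X = {x | ∀ p ∈ S, MvPolynomial.eval x p = 0}

/-- The differential of a polynomial at a point, as a linear functional. -/
def diffAt {n : ℕ} (p : MvPolynomial (Fin n) ℂ) (x : Fin n → ℂ) : (Fin n → ℂ) →ₗ[ℂ] ℂ :=
  ∑ i, MvPolynomial.eval x (MvPolynomial.pderiv i p) • LinearMap.proj i

/-- The Zariski tangent space of `X ⊆ ℂⁿ` at `x`. -/
def zTangent {n : ℕ} (X : Set (Fin n → ℂ)) (x : Fin n → ℂ) : Submodule ℂ (Fin n → ℂ) :=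
  ⨅ p ∈ {p : MvPolynomial (Fin n) ℂ | ∀ y ∈ X, MvPolynomial.eval y p = 0},
    LinearMap.ker (diffAt p x)

/-- `ψ` is a local holomorphic parametrization of `S` around `x`, with `d` parameters. -/
def IsParamAt {E : Type} [NormedAddCommGroup E] [NormedSpace ℂ E]
    (S : Set E) (x : E) (d : ℕ) (ψ : (Fin d → ℂ) → E) (U : Set (Fin d → ℂ)) : Prop :=
  IsOpen U ∧ (0 : Fin d → ℂ) ∈ U ∧ ψ 0 = x ∧ DifferentiableOn ℂ ψ U ∧
    Set.InjOn ψ U ∧ Function.Injective (fderiv ℂ ψ 0) ∧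
    ∃ V ∈ 𝓝 x, ψ '' U = S ∩ V

/-- `S` is, near `x`, a `d`-dimensional complex submanifold. -/
def IsSmoothGermAt {E : Type} [NormedAddCommGroup E] [NormedSpace ℂ E]
    (S : Set E) (x : E) (d : ℕ) : Prop :=
  ∃ ψ U, IsParamAt S x d ψ U

/-- `X` is a (nonempty) smooth closed subvariety of ℂⁿ of pure dimension `d`. -/
def IsSmoothClosedOfDim {n : ℕ} (X : Set (Fin n → ℂ)) (d : ℕ) : Prop :=
  IsAlgSet X ∧ X.Nonempty ∧
    ∀ x ∈ X, IsSmoothGermAt X x d ∧ Module.finrank ℂ ↥(zTangent X x) = d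

/-- Critical points of the squared distance function `f_α` on the locus of `X` where
the tangent space has dimension `d` (the smooth locus, when `dim X = d`):
the vector `x - α` is orthogonal to the tangent space w.r.t. `∑ zᵢwᵢ`. -/
def edCritSet {n : ℕ} (X : Set (Fin n → ℂ)) (d : ℕ) (α : Fin n → ℂ) : Set (Fin n → ℂ) :=
  {x | x ∈ X ∧ Module.finrank ℂ ↥(zTangent X x) = d ∧
    ∀ v ∈ zTangent X x, (∑ i, (x i - α i) * v i) = 0}

/-- The Euclidean distance degree of `X` (of dimension `d`) equals `k`: for a general
data point `α`, the squared distance function `f_α` has exactly `k` critical points on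
the smooth locus of `X`. -/
def HasEDDeg {n : ℕ} (X : Set (Fin n → ℂ)) (d : ℕ) (k : ℕ) : Prop :=
  Generically (K := ℂ) (σ := Fin n) fun α =>
    (edCritSet X d α).Finite ∧ (edCritSet X d α).ncard = k

/-- `U_β`: the complement in ℂⁿ of the hypersurface `∑ (zᵢ - βᵢ)² + β₀ = 0`. -/
def quadCompl {n : ℕ} (β : Fin (n + 1) → ℂ) : Set (Fin n → ℂ) :=
  {z | (∑ i : Fin n, (z i - β i.succ) ^ 2) + β 0 ≠ 0}

/-! Topological Euler characteristic, via homotopy equivalence with a space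
built from finitely many cells. -/

def cellSphere (d : ℕ) : Set (EuclideanSpace ℝ (Fin d)) := Metric.sphere 0 1
def cellBall (d : ℕ) : Set (EuclideanSpace ℝ (Fin d)) := Metric.closedBall 0 1

def attachRel {d : ℕ} {A : Type} [TopologicalSpace A] (φ : C(↥(cellSphere d), A)) :
    (A ⊕ ↥(cellBall d)) → (A ⊕ ↥(cellBall d)) → Prop := fun p q =>
  ∃ x : ↥(cellSphere d),
    p = Sum.inl (φ x) ∧ q = Sum.inr ⟨x.1, Metric.sphere_subset_closedBall x.2⟩

/-- The space obtained from `A` by attaching a `d`-cell along `φ`. -/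
def attachSp {d : ℕ} {A : Type} [TopologicalSpace A] (φ : C(↥(cellSphere d), A)) : Type :=
  Quot (attachRel φ)

instance {d : ℕ} {A : Type} [TopologicalSpace A] (φ : C(↥(cellSphere d), A)) :
    TopologicalSpace (attachSp φ) := inferInstanceAs (TopologicalSpace (Quot _))

/-- `B` is (homeomorphic to) the result of attaching one `d`-cell to `A`. -/
def AttachOneCell (A B : TopCat.{0}) (d : ℕ) : Prop :=
  ∃ φ : C(↥(cellSphere d), ↑A), Nonempty (↑B ≃ₜ attachSp φ)

/-- `Z` is obtained from `A` by attaching cells whose dimensions are listed in `L`. -/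
def AttachedCells : TopCat.{0} → TopCat.{0} → List ℕ → Prop
  | A, Z, [] => Nonempty (↑A ≃ₜ ↑Z)
  | A, Z, d :: L => ∃ B : TopCat.{0}, AttachOneCell A B d ∧ AttachedCells B Z L

/-- `X` has (topological) Euler characteristic `c`: `X` is homotopy equivalent to a
space built from finitely many cells, and `c` is the alternating sum of the
numbers of cells. -/
def HasEulerChar (X : Type) [TopologicalSpace X] (c : ℤ) : Prop :=
  ∃ (Z : TopCat.{0}) (L : List ℕ),
    AttachedCells (TopCat.of Empty) Z L ∧
    Nonempty (ContinuousMap.HomotopyEquiv X ↑Z) ∧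
    c = (L.map fun d => (-1 : ℤ) ^ d).sum

/-! The multiview variety of `n` cameras in `(ℙ²)ⁿ` and its affine chart. -/

abbrev P2 := Projectivization ℂ (Fin 3 → ℂ)

instance : TopologicalSpace P2 :=
  @instTopologicalSpaceQuotient _ (projectivizationSetoid ℂ (Fin 3 → ℂ)) _

/-- The point of ℙ² with homogeneous coordinate vector `v` (junk value if `v = 0`). -/
def mkP (v : Fin 3 → ℂ) : P2 :=
  if h : v ≠ 0 then Projectivization.mk ℂ v h
  else Projectivization.mk ℂ (fun _ => 1) (by
    intro h0; exact one_ne_zero (congrFun h0 0))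

/-- The tuple of cameras (3×4 matrices) with complex parameters `a`. -/
def camOfC {n : ℕ} (a : Fin n × Fin 3 × Fin 4 → ℂ) : Fin n → Matrix (Fin 3) (Fin 4) ℂ :=
  fun i => Matrix.of fun r c => a (i, r, c)

/-- The tuple of cameras with real parameters `a`, viewed as complex matrices. -/
def camOfR {n : ℕ} (a : Fin n × Fin 3 × Fin 4 → ℝ) : Fin n → Matrix (Fin 3) (Fin 4) ℂ :=
  fun i => Matrix.of fun r c => (a (i, r, c) : ℂ)

/-- The tuple of chart matrices (elements of GL₃ giving affine charts of ℙ²). -/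
def chartOf {n : ℕ} (cpar : Fin n × Fin 3 × Fin 3 → ℂ) : Fin n → Matrix (Fin 3) (Fin 3) ℂ :=
  fun i => Matrix.of fun r c => cpar (i, r, c)

/-- The image of the joint camera map `ℙ³ ⇢ (ℙ²)ⁿ` (on its locus of definition). -/
def mvImage {n : ℕ} (A : Fin n → Matrix (Fin 3) (Fin 4) ℂ) : Set (Fin n → P2) :=
  {P | ∃ y : Fin 4 → ℂ, y ≠ 0 ∧ (∀ i, (A i).mulVec y ≠ 0) ∧ ∀ i, P i = mkP ((A i).mulVec y)}

/-- The multiview variety `Yₙ ⊆ (ℙ²)ⁿ`: the closure of the image of the camera map. -/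
def mvVariety {n : ℕ} (A : Fin n → Matrix (Fin 3) (Fin 4) ℂ) : Set (Fin n → P2) :=
  closure (mvImage A)

def affLift (z : Fin 2 → ℂ) : Fin 3 → ℂ := Fin.cons 1 z

/-- The coordinate pair of the `i`-th factor, for `z ∈ ℂ²ⁿ`. -/
def camCoord (n : ℕ) (z : Fin (2 * n) → ℂ) (i : Fin n) : Fin 2 → ℂ :=
  fun k => z ⟨2 * i.1 + k.1, by have := i.2; have := k.2; omega⟩

/-- The affine chart `ℂ²ⁿ → (ℙ²)ⁿ` determined by the chart matrices `Cs`. -/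
def chartMapN {n : ℕ} (Cs : Fin n → Matrix (Fin 3) (Fin 3) ℂ) (z : Fin (2 * n) → ℂ) :
    Fin n → P2 :=
  fun i => mkP ((Cs i).mulVec <| affLift (camCoord n z i))

/-- The affine multiview variety `Xₙ = Yₙ ∩ ℂ²ⁿ ⊆ ℂ²ⁿ`, in the chart `Cs`. -/
def affineMV {n : ℕ} (A : Fin n → Matrix (Fin 3) (Fin 4) ℂ)
    (Cs : Fin n → Matrix (Fin 3) (Fin 3) ℂ) : Set (Fin (2 * n) → ℂ) :=
  chartMapN Cs ⁻¹' mvVariety A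

/-- The line at infinity of the affine chart of ℙ² given by the matrix `Cm`. -/
def infLine (Cm : Matrix (Fin 3) (Fin 3) ℂ) : Set P2 :=
  {p | ∃ w : Fin 3 → ℂ, w ≠ 0 ∧ w 0 = 0 ∧ p = mkP (Cm.mulVec w)}

/-- `D_{∞,i} = Yₙ ∩ H_{∞,i}`. -/
def Dinf {n : ℕ} (A : Fin n → Matrix (Fin 3) (Fin 4) ℂ)
    (Cs : Fin n → Matrix (Fin 3) (Fin 3) ℂ) (i : Fin n) : Set (Fin n → P2) :=
  mvVariety A ∩ {P | P i ∈ infLine (Cs i)}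

/-- `D_∞ = Yₙ ∩ H_∞`, the divisor at infinity. -/
def DinfAll {n : ℕ} (A : Fin n → Matrix (Fin 3) (Fin 4) ℂ)
    (Cs : Fin n → Matrix (Fin 3) (Fin 3) ℂ) : Set (Fin n → P2) :=
  mvVariety A ∩ ⋃ i, {P | P i ∈ infLine (Cs i)}

/-- The affine quadric hypersurface `∑ (zᵢ - βᵢ)² + β₀ = 0` in `ℂ²ⁿ`. -/
def quadSet (n : ℕ) (β : Fin (2 * n + 1) → ℂ) : Set (Fin (2 * n) → ℂ) :=
  {z | (∑ i : Fin (2 * n), (z i - β i.succ) ^ 2) + β 0 = 0}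

/-- `H_Q`: the closure in `(ℙ²)ⁿ` of the affine quadric hypersurface. -/
def HQ {n : ℕ} (Cs : Fin n → Matrix (Fin 3) (Fin 3) ℂ) (β : Fin (2 * n + 1) → ℂ) :
    Set (Fin n → P2) :=
  closure (chartMapN Cs '' quadSet n β)

/-- `D_Q = Yₙ ∩ H_Q`. -/
def DQ {n : ℕ} (A : Fin n → Matrix (Fin 3) (Fin 4) ℂ)
    (Cs : Fin n → Matrix (Fin 3) (Fin 3) ℂ) (β : Fin (2 * n + 1) → ℂ) :
    Set (Fin n → P2) :=
  mvVariety A ∩ HQ Cs β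

/-! Cell complexes built inside a Hausdorff space. -/

/-- Attaching a cell is invariant under homeomorphisms of the base. -/
lemma AttachOneCell.congr_left {A A' B : TopCat.{0}} {d : ℕ} (e : ↑A ≃ₜ ↑A')
    (h : AttachOneCell A' B d) : AttachOneCell A B d := by
  obtain ⟨φ, ⟨f⟩⟩ := h
  let φ' : C(↥(cellSphere d), ↑A) := ⟨fun x => e.symm (φ x), by fun_prop⟩
  refine ⟨φ', ⟨f.trans ?_⟩⟩
  have hto : ∀ p q, attachRel φ p q →
      Quot.mk (attachRel φ') (Sum.map e.symm id p) = Quot.mk _ (Sum.map e.symm id q) := by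
    rintro _ _ ⟨x, rfl, rfl⟩
    exact Quot.sound ⟨x, rfl, rfl⟩
  have hinv : ∀ p q, attachRel φ' p q →
      Quot.mk (attachRel φ) (Sum.map e id p) = Quot.mk _ (Sum.map e id q) := by
    rintro _ _ ⟨x, rfl, rfl⟩
    exact Quot.sound ⟨x, by simp [φ'], rfl⟩
  exact
    { toFun := Quot.lift (fun p => Quot.mk _ (Sum.map e.symm id p)) hto
      invFun := Quot.lift (fun p => Quot.mk _ (Sum.map e id p)) hinv
      left_inv := by
        rintro ⟨p⟩
        rcases p with p | p
        · exact congrArg (Quot.mk _) (congrArg Sum.inl (e.apply_symm_apply p))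
        · rfl
      right_inv := by
        rintro ⟨p⟩
        rcases p with p | p
        · exact congrArg (Quot.mk _) (congrArg Sum.inl (e.symm_apply_apply p))
        · rfl
      continuous_toFun := continuous_quot_lift _
        (continuous_quot_mk.comp (e.symm.continuous.sumMap continuous_id))
      continuous_invFun := continuous_quot_lift _
        (continuous_quot_mk.comp (e.continuous.sumMap continuous_id)) }

lemma AttachedCells.snoc {B' : TopCat.{0}} {d : ℕ} : ∀ {L : List ℕ} {A B : TopCat.{0}},
    AttachedCells A B L → AttachOneCell B B' d → AttachedCells A B' (L ++ [d])
  | [], _, _, ⟨e⟩, h => ⟨B', h.congr_left e, ⟨Homeomorph.refl _⟩⟩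
  | _ :: _, _, _, ⟨B₁, h₁, h₂⟩, h => ⟨B₁, h₁, AttachedCells.snoc h₂ h⟩

/-- `K` is compact and has a presentation as a finite cell complex of Euler characteristic `c`. -/
def CellBuilt {Z : Type} [TopologicalSpace Z] (K : Set Z) (c : ℤ) : Prop :=
  IsCompact K ∧ ∃ L : List ℕ, AttachedCells (TopCat.of Empty) (TopCat.of K) L ∧
    c = (L.map fun d => (-1 : ℤ) ^ d).sum

lemma cellBuilt_empty {Z : Type} [TopologicalSpace Z] : CellBuilt (∅ : Set Z) 0 :=
  ⟨isCompact_empty, [], ⟨(Homeomorph.empty : Empty ≃ₜ ↥(∅ : Set Z))⟩, by simp⟩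

lemma attachOneCell_of_ball {Z : Type} [TopologicalSpace Z] [T2Space Z] {K : Set Z}
    (hK : IsCompact K) {d : ℕ} (Φ : EuclideanSpace ℝ (Fin d) → Z)
    (hΦ : ContinuousOn Φ (Metric.closedBall 0 1))
    (hbd : ∀ x ∈ Metric.sphere (0 : EuclideanSpace ℝ (Fin d)) 1, Φ x ∈ K)
    (hinj : Set.InjOn Φ (Metric.ball 0 1)) (hdisj : ∀ x ∈ Metric.ball 0 1, Φ x ∉ K) :
    AttachOneCell (TopCat.of K) (TopCat.of ↥(K ∪ Φ '' Metric.ball 0 1)) d := by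
  have hmem : ∀ x ∈ Metric.closedBall (0 : EuclideanSpace ℝ (Fin d)) 1,
      Φ x ∈ K ∪ Φ '' Metric.ball 0 1 := by
    intro x hx
    rcases (Metric.mem_closedBall.1 hx).lt_or_eq with h | h
    · exact Or.inr ⟨x, h, rfl⟩
    · exact Or.inl (hbd x h)
  have hΦc : Continuous fun x : ↥(cellBall d) => Φ x := continuousOn_iff_continuous_domRestrict.1 hΦ
  let φ : C(↥(cellSphere d), ↑(TopCat.of K)) := ⟨fun x => ⟨Φ x, hbd x x.2⟩,
    (hΦc.comp (continuous_inclusion Metric.sphere_subset_closedBall)).subtype_mk _⟩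
  let F₀ : ↥K ⊕ ↥(cellBall d) → ↥(K ∪ Φ '' Metric.ball 0 1) :=
    Sum.elim (Set.inclusion Set.subset_union_left) fun x => ⟨Φ x, hmem x x.2⟩
  have hF₀ : Continuous F₀ :=
    (continuous_inclusion _).sumElim (hΦc.subtype_mk _)
  let F : attachSp φ → ↥(K ∪ Φ '' Metric.ball 0 1) := Quot.lift F₀ (by
    rintro _ _ ⟨x, rfl, rfl⟩; rfl)
  have hF : Continuous F := continuous_quot_lift _ hF₀
  have hglue : ∀ x : ↥(cellBall d), (h : ‖x.1‖ = 1) →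
      (Quot.mk (attachRel φ) (Sum.inr x) : attachSp φ) =
        Quot.mk _ (Sum.inl (φ ⟨x.1, by simpa [cellSphere] using h⟩)) := fun x h =>
    (Quot.sound ⟨⟨x.1, by simpa [cellSphere] using h⟩, rfl, rfl⟩).symm
  have hcases : ∀ x : ↥(cellBall d), ‖x.1‖ < 1 ∨ ‖x.1‖ = 1 := fun x =>
    lt_or_eq_of_le (by simpa [cellBall] using x.2)
  have key : ∀ q : attachSp φ, (∃ k : ↥K, q = Quot.mk _ (Sum.inl k)) ∨
      ∃ x : ↥(cellBall d), ‖x.1‖ < 1 ∧ q = Quot.mk _ (Sum.inr x) := by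
    rintro ⟨k | x⟩
    · exact Or.inl ⟨k, rfl⟩
    · rcases hcases x with h | h
      · exact Or.inr ⟨x, h, rfl⟩
      · exact Or.inl ⟨_, hglue x h⟩
  have hFinj : Function.Injective F := by
    intro p q hpq
    have hpq' := congrArg Subtype.val hpq
    rcases key p with ⟨k, rfl⟩ | ⟨x, hx, rfl⟩ <;> rcases key q with ⟨l, rfl⟩ | ⟨y, hy, rfl⟩
    · exact congrArg _ (congrArg Sum.inl (Subtype.ext hpq'))
    · exact absurd (show Φ y ∈ K from (show (k : Z) = Φ y from hpq') ▸ k.2)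
        (hdisj y (by simpa using hy))
    · exact absurd (show Φ x ∈ K from (show Φ x = (l : Z) from hpq') ▸ l.2)
        (hdisj x (by simpa using hx))
    · exact congrArg _ (congrArg Sum.inr (Subtype.ext
        (hinj (by simpa using hx) (by simpa using hy) hpq')))
  have hFsurj : Function.Surjective F := by
    rintro ⟨z, hz | ⟨x, hx, rfl⟩⟩
    · exact ⟨Quot.mk _ (Sum.inl ⟨z, hz⟩), rfl⟩
    · exact ⟨Quot.mk _ (Sum.inr ⟨x, Metric.ball_subset_closedBall hx⟩), rfl⟩
  have : CompactSpace ↥K := isCompact_iff_compactSpace.1 hK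
  have : CompactSpace ↥(cellBall d) :=
    isCompact_iff_compactSpace.1 (isCompact_closedBall (0 : EuclideanSpace ℝ (Fin d)) 1)
  have : CompactSpace (attachSp φ) := inferInstanceAs (CompactSpace (Quot (attachRel φ)))
  exact ⟨φ, ⟨(Continuous.homeoOfEquivCompactToT2 (f := Equiv.ofBijective F ⟨hFinj, hFsurj⟩)
    hF).symm⟩⟩

/-- Adding a convex cell along a characteristic map. -/
lemma CellBuilt.attach {Z : Type} [TopologicalSpace Z] [T2Space Z] {K : Set Z} {c : ℤ}
    (hK : CellBuilt K c) {E : Type} [NormedAddCommGroup E] [NormedSpace ℝ E]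
    [FiniteDimensional ℝ E] {C : Set E} (hconv : Convex ℝ C) (hcomp : IsCompact C)
    (hne : (interior C).Nonempty) (Φ : E → Z) (hΦ : ContinuousOn Φ C)
    (hbd : ∀ x ∈ C, x ∉ interior C → Φ x ∈ K) (hinj : Set.InjOn Φ (interior C))
    (hdisj : ∀ x ∈ interior C, Φ x ∉ K) :
    CellBuilt (K ∪ Φ '' interior C) (c + (-1) ^ Module.finrank ℝ E) := by
  let e : E ≃L[ℝ] EuclideanSpace ℝ (Fin (Module.finrank ℝ E)) :=
    ContinuousLinearEquiv.ofFinrankEq (by simp)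
  have hint : interior (e '' C) = e '' interior C := (e.toHomeomorph.image_interior C).symm
  obtain ⟨h, hi, hc, -⟩ := exists_homeomorph_image_interior_closure_frontier_eq_unitBall
    (s := e '' C) (hconv.linear_image e.toLinearMap) (hint ▸ hne.image e)
    (hcomp.image e.continuous).isBounded
  rw [(hcomp.image e.continuous).isClosed.closure_eq] at hc
  rw [hint] at hi
  let k : EuclideanSpace ℝ (Fin (Module.finrank ℝ E)) ≃ₜ E := h.symm.trans e.symm.toHomeomorph
  have hball : k '' Metric.ball 0 1 = interior C := by
    rw [← hi, Set.image_image, Set.image_image]; simp [k]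
  have hcball : k '' Metric.closedBall 0 1 = C := by
    rw [← hc, Set.image_image, Set.image_image]; simp [k]
  have hmb : ∀ x, k x ∈ interior C ↔ x ∈ Metric.ball 0 1 := fun x => by
    rw [← hball, k.injective.mem_set_image]
  have hmc : ∀ x, k x ∈ C ↔ x ∈ Metric.closedBall 0 1 := fun x => by
    rw [← hcball, k.injective.mem_set_image]
  obtain ⟨hKc, L, hL, rfl⟩ := hK
  have himg : (Φ ∘ k) '' Metric.ball 0 1 = Φ '' interior C := by
    rw [Set.image_comp, hball]
  have hatt := attachOneCell_of_ball hKc (Φ ∘ k)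
    (hΦ.comp k.continuous.continuousOn fun x hx => (hmc x).2 hx)
    (fun x hx => hbd _ ((hmc x).2 (Metric.sphere_subset_closedBall hx)) fun hx' => by
      have h1 := (hmb x).1 hx'
      simp only [Metric.mem_ball, Metric.mem_sphere] at h1 hx
      exact h1.ne hx)
    (fun x hx y hy hxy => k.injective (hinj ((hmb x).2 hx) ((hmb y).2 hy) hxy))
    (fun x hx => hdisj _ ((hmb x).2 hx))
  rw [himg] at hatt
  refine ⟨?_, L ++ [Module.finrank ℝ E], hL.snoc hatt, by simp⟩
  have hset : K ∪ Φ '' interior C = K ∪ Φ '' C := by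
    apply Set.Subset.antisymm
    · exact Set.union_subset_union_right _ (Set.image_mono interior_subset)
    · rintro _ (hz | ⟨x, hx, rfl⟩)
      · exact Or.inl hz
      · by_cases hxi : x ∈ interior C
        · exact Or.inr ⟨x, hxi, rfl⟩
        · exact Or.inl (hbd x hx hxi)
  rw [hset]
  exact hKc.union (hcomp.image_of_continuousOn hΦ)

/-! The blown-up union of a finite family of sets. -/

/-- The blown-up union of a family of sets: points weighted by a point of the simplex spanned by
the members of the family containing them. -/
def blowupUnion {Z : Type} {n : ℕ} (H : Fin n → Set Z) : Set (Z × (Fin n → ℝ)) :=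
  {p | p.2 ∈ stdSimplex ℝ (Fin n) ∧ ∀ i, p.2 i ≠ 0 → p.1 ∈ H i}

lemma blowupUnion_fst_mem {Z : Type} {n : ℕ} {H : Fin n → Set Z} {p : Z × (Fin n → ℝ)}
    (hp : p ∈ blowupUnion H) : p.1 ∈ ⋃ i, H i := by
  obtain ⟨i, hi⟩ : ∃ i, p.2 i ≠ 0 := by
    by_contra! h
    have := hp.1.2
    simp [h] at this
  exact Set.mem_iUnion.2 ⟨i, hp.2 i hi⟩

/-- If a union of sets can be deformed, preserving each of them, by a map that is locally into one
of the sets, then the union is homotopy equivalent to the blown-up union. -/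
lemma homotopyEquiv_blowupUnion {Z : Type} [TopologicalSpace Z] {n : ℕ} (H : Fin n → Set Z)
    (g : C(↥(⋃ i, H i) × unitInterval, ↥(⋃ i, H i))) (lam : C(↥(⋃ i, H i), Fin n → ℝ))
    (hlam : ∀ x, lam x ∈ stdSimplex ℝ (Fin n)) (h0 : ∀ x, g (x, 0) = x)
    (hpres : ∀ x t i, x.1 ∈ H i → (g (x, t)).1 ∈ H i)
    (hsnap : ∀ x i, lam x i ≠ 0 → (g (x, 1)).1 ∈ H i) :
    Nonempty (ContinuousMap.HomotopyEquiv ↥(⋃ i, H i) ↥(blowupUnion H)) := by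
  let s : C(↥(⋃ i, H i), ↥(blowupUnion H)) :=
    ⟨fun x => ⟨((g (x, 1)).1, lam x), hlam x, fun i hi => hsnap x i hi⟩, by fun_prop⟩
  let p : C(↥(blowupUnion H), ↥(⋃ i, H i)) :=
    ⟨fun y => ⟨y.1.1, blowupUnion_fst_mem y.2⟩, by fun_prop⟩
  let mid : C(↥(blowupUnion H), ↥(blowupUnion H)) :=
    ⟨fun y => ⟨((g (p y, 1)).1, y.1.2), y.2.1, fun i hi => hpres _ _ _ (y.2.2 i hi)⟩, by fun_prop⟩
  have hps : (ContinuousMap.id _).Homotopic (p.comp s) :=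
    ⟨{ toFun := fun q => g (q.2, q.1)
       continuous_toFun := by fun_prop
       map_zero_left := h0
       map_one_left := fun x => rfl }⟩
  have h1 : (ContinuousMap.id _).Homotopic mid :=
    ⟨{ toFun := fun q => ⟨((g (p q.2, q.1)).1, q.2.1.2), q.2.2.1, fun i hi =>
          hpres _ _ _ (q.2.2.2 i hi)⟩
       continuous_toFun := by fun_prop
       map_zero_left := fun y => Subtype.ext (Prod.ext (by simp [h0, p]) rfl)
       map_one_left := fun x => rfl }⟩
  have h2 : mid.Homotopic (s.comp p) :=
    ⟨{ toFun := fun q => ⟨((g (p q.2, 1)).1,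
          (1 - (q.1 : ℝ)) • q.2.1.2 + (q.1 : ℝ) • lam (p q.2)),
          convex_stdSimplex ℝ _ q.2.2.1 (hlam _) (by linarith [q.1.2.2]) q.1.2.1 (by ring),
          fun i hi => by
            by_cases hl : lam (p q.2) i = 0
            · refine hpres _ _ _ (q.2.2.2 i fun h => hi ?_)
              simp [hl, h]
            · exact hsnap _ _ hl⟩
       continuous_toFun := by fun_prop
       map_zero_left := fun y => Subtype.ext (Prod.ext rfl (by simp [mid]))
       map_one_left := fun x => Subtype.ext (Prod.ext rfl (by simp [s])) }⟩
  exact ⟨⟨s, p, hps.symm, (h1.trans h2).symm⟩⟩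

lemma HasEulerChar.of_blowupUnion {Z : Type} [TopologicalSpace Z] {n : ℕ} {H : Fin n → Set Z}
    {c : ℤ} (hc : CellBuilt (blowupUnion H) c)
    (he : Nonempty (ContinuousMap.HomotopyEquiv ↥(⋃ i, H i) ↥(blowupUnion H))) :
    HasEulerChar ↥(⋃ i, H i) c := by
  obtain ⟨-, L, hL, rfl⟩ := hc
  exact ⟨TopCat.of _, L, hL, he, rfl⟩

/-! Building the blown-up union stratum by stratum. -/

/-- The set of indices with nonzero weight. -/
def wsupp {n : ℕ} (w : Fin n → ℝ) : Finset (Fin n) := {i | w i ≠ 0}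

@[simp] lemma mem_wsupp {n : ℕ} {w : Fin n → ℝ} {i : Fin n} : i ∈ wsupp w ↔ w i ≠ 0 := by
  simp [wsupp]

/-- The part of the blown-up union with weights supported exactly on members of `𝒮`. -/
def strata {Z : Type} {n : ℕ} (H : Fin n → Set Z) (𝒮 : Finset (Finset (Fin n))) :
    Set (Z × (Fin n → ℝ)) :=
  {p | p ∈ blowupUnion H ∧ wsupp p.2 ∈ 𝒮}

lemma wsupp_nonempty {n : ℕ} {w : Fin n → ℝ} (hw : w ∈ stdSimplex ℝ (Fin n)) :
    (wsupp w).Nonempty := by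
  by_contra! h
  have h0 : ∀ i, w i = 0 := fun i => by
    by_contra hi
    have : i ∈ wsupp w := mem_wsupp.2 hi
    simp [h] at this
  have := hw.2
  simp [h0] at this

/-- Adding the stratum of any set of cardinality `k` to a union of strata containing all smaller
ones changes the Euler characteristic by `χ`. -/
def StratumStep {Z : Type} [TopologicalSpace Z] {n : ℕ} (H : Fin n → Set Z) (k : ℕ) (χ : ℤ) :
    Prop :=
  ∀ (S : Finset (Fin n)) (𝒮 : Finset (Finset (Fin n))) (c : ℤ), S.card = k → S ∉ 𝒮 →
    (∀ T ⊂ S, T.Nonempty → T ∈ 𝒮) → CellBuilt (strata H 𝒮) c →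
    CellBuilt (strata H (insert S 𝒮)) (c + χ)

lemma StratumStep.add_layer {Z : Type} [TopologicalSpace Z] {n : ℕ} {H : Fin n → Set Z} {k : ℕ}
    {χ : ℤ} (h : StratumStep H k χ) {𝒮 : Finset (Finset (Fin n))} {c : ℤ}
    (h𝒮 : ∀ S, S ∈ 𝒮 ↔ S.Nonempty ∧ S.card < k) (hc : CellBuilt (strata H 𝒮) c)
    (𝒯 : Finset (Finset (Fin n))) (h𝒯 : ∀ T ∈ 𝒯, T.card = k) :
    CellBuilt (strata H (𝒯 ∪ 𝒮)) (c + 𝒯.card * χ) := by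
  induction 𝒯 using Finset.induction_on with
  | empty => simpa using hc
  | insert T 𝒯 hT ih =>
    have hTk := h𝒯 T (Finset.mem_insert_self _ _)
    have := h T (𝒯 ∪ 𝒮) _ hTk
      (by rw [Finset.mem_union, h𝒮]; rintro (h | h); exacts [hT h, by omega])
      (fun U hU hne => Finset.mem_union_right _
        ((h𝒮 U).2 ⟨hne, hTk ▸ Finset.card_lt_card hU⟩))
      (ih fun U hU => h𝒯 U (Finset.mem_insert_of_mem hU))
    rw [Finset.insert_union, Finset.card_insert_of_notMem hT]
    convert this using 1
    push_cast
    ring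

lemma cellBuilt_blowupUnion {Z : Type} [TopologicalSpace Z] {n : ℕ} {H : Fin n → Set Z}
    {χ₁ χ₂ χ₃ : ℤ} (h₁ : StratumStep H 1 χ₁) (h₂ : StratumStep H 2 χ₂) (h₃ : StratumStep H 3 χ₃)
    (h₄ : ∀ p ∈ blowupUnion H, (wsupp p.2).card < 4) :
    CellBuilt (blowupUnion H) (n * χ₁ + n.choose 2 * χ₂ + n.choose 3 * χ₃) := by
  have e0 : CellBuilt (strata H ∅) 0 := by
    convert cellBuilt_empty (Z := Z × (Fin n → ℝ))
    simp [strata]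
  let P : ℕ → Finset (Finset (Fin n)) := fun k => Finset.univ.powersetCard k
  have hP : ∀ k, ∀ T ∈ P k, T.card = k := fun k T hT => (Finset.mem_powersetCard.1 hT).2
  have hmem : ∀ k T, T ∈ P k ↔ T.card = k := by simp [P, Finset.mem_powersetCard]
  have e1 := h₁.add_layer (by simp [Finset.nonempty_iff_ne_empty]) e0 (P 1) (hP 1)
  have e2 := h₂.add_layer (by
    intro S
    have := Finset.card_pos (s := S)
    simp only [Finset.mem_union, hmem, Finset.notMem_empty, or_false]
    rw [← this]; omega) e1 (P 2) (hP 2)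
  have e3 := h₃.add_layer (by
    intro S
    have := Finset.card_pos (s := S)
    simp only [Finset.mem_union, hmem, Finset.notMem_empty, or_false]
    rw [← this]; omega) e2 (P 3) (hP 3)
  convert e3 using 1
  · ext p
    simp only [strata, Set.mem_ofPred_eq, Finset.mem_union, hmem, Finset.notMem_empty, or_false]
    refine ⟨fun hp => ⟨hp, ?_⟩, fun hp => hp.1⟩
    have := h₄ p hp
    have := (wsupp_nonempty hp.1).card_pos
    omega
  · simp [P]

/-! The topology of `P2`. -/

lemma mkP_of_ne {v : Fin 3 → ℂ} (h : v ≠ 0) : mkP v = Projectivization.mk ℂ v h := dif_pos h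

lemma mkP_eq_iff {v w : Fin 3 → ℂ} (hv : v ≠ 0) (hw : w ≠ 0) :
    mkP v = mkP w ↔ ∃ μ : ℂ, w = μ • v := by
  rw [eq_comm, mkP_of_ne hv, mkP_of_ne hw, Projectivization.mk_eq_mk_iff']
  exact ⟨fun ⟨a, h⟩ => ⟨a, h.symm⟩, fun ⟨a, h⟩ => ⟨a, h.symm⟩⟩

lemma mkP_smul {μ : ℂ} (hμ : μ ≠ 0) (v : Fin 3 → ℂ) : mkP (μ • v) = mkP v := by
  by_cases hv : v = 0
  · simp [hv]
  · exact ((mkP_eq_iff hv (smul_ne_zero hμ hv)).2 ⟨μ, rfl⟩).symm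

lemma exists_mkP (p : P2) : ∃ v, v ≠ 0 ∧ p = mkP v := by
  induction p using Projectivization.ind with
  | h v hv => exact ⟨v, hv, (mkP_of_ne hv).symm⟩

lemma continuous_mk_P2 :
    Continuous fun v : {v : Fin 3 → ℂ // v ≠ 0} => (Projectivization.mk ℂ v.1 v.2 : P2) :=
  continuous_quotient_mk'

lemma continuousAt_mkP {v : Fin 3 → ℂ} (hv : v ≠ 0) : ContinuousAt mkP v := by
  have h : ContinuousOn mkP {v : Fin 3 → ℂ | v ≠ 0} := by
    rw [continuousOn_iff_continuous_domRestrict]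
    exact continuous_mk_P2.congr fun v => (mkP_of_ne v.2).symm
  exact h.continuousAt (isOpen_ne.mem_nhds hv)

/-- The orthogonal projection matrix onto the line spanned by a vector, entrywise. -/
def projEntry (v : Fin 3 → ℂ) (r s : Fin 3) : ℂ :=
  v r * star (v s) / ∑ k, v k * star (v k)

lemma sum_mul_star_ne_zero {v : Fin 3 → ℂ} (hv : v ≠ 0) : ∑ k, v k * star (v k) ≠ 0 := by
  intro h
  apply hv
  have hre : ∑ k, Complex.normSq (v k) = 0 := by
    have := congrArg Complex.re h
    simpa [Complex.mul_conj] using this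
  funext k
  exact Complex.normSq_eq_zero.1
    ((Finset.sum_eq_zero_iff_of_nonneg fun k _ => Complex.normSq_nonneg _).1 hre k (by simp))

lemma projEntry_smul {μ : ℂ} (hμ : μ ≠ 0) (v : Fin 3 → ℂ) :
    projEntry (μ • v) = projEntry v := by
  funext r s
  have : ∑ k, (μ • v) k * star ((μ • v) k) = μ * star μ * ∑ k, v k * star (v k) := by
    rw [Finset.mul_sum]
    exact Finset.sum_congr rfl fun k _ => by simp; ring
  rw [projEntry, this, projEntry]
  have h2 : μ * star μ ≠ 0 := mul_ne_zero hμ (star_ne_zero.2 hμ)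
  rw [show (μ • v) r * star ((μ • v) s) = μ * star μ * (v r * star (v s)) by simp; ring]
  exact mul_div_mul_left _ _ h2

lemma smul_eq_of_projEntry_eq {v w : Fin 3 → ℂ} (hv : v ≠ 0) (hw : w ≠ 0)
    (h : projEntry v = projEntry w) : ∃ μ : ℂ, v = μ • w := by
  obtain ⟨s, hs⟩ := Function.ne_iff.1 hv
  have hsv := sum_mul_star_ne_zero hv
  have hsw := sum_mul_star_ne_zero hw
  have hs' : star (v s) ≠ 0 := star_ne_zero.2 hs
  refine ⟨(∑ k, v k * star (v k)) / star (v s) * (star (w s) / ∑ k, w k * star (w k)), ?_⟩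
  funext r
  have hr := congrFun (congrFun h r) s
  simp only [projEntry] at hr
  rw [Pi.smul_apply, smul_eq_mul]
  field_simp at hr ⊢
  linear_combination hr

lemma continuous_projEntry :
    Continuous fun v : {v : Fin 3 → ℂ // v ≠ 0} => projEntry v.1 := by
  refine continuous_pi fun r => continuous_pi fun s => ?_
  unfold projEntry
  have hmul : ∀ r s : Fin 3, Continuous fun v : {v : Fin 3 → ℂ // v ≠ 0} =>
      v.1 r * star (v.1 s) := fun r s =>
    ((continuous_apply r).comp continuous_subtype_val).mul
      (continuous_star.comp ((continuous_apply s).comp continuous_subtype_val))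
  exact (hmul r s).div (continuous_finsetSum _ fun k _ => hmul k k)
    fun v => sum_mul_star_ne_zero v.2

/-- The orthogonal projection matrix onto the line represented by a point of `P2`. -/
def projMat : P2 → Fin 3 → Fin 3 → ℂ := Projectivization.lift (fun v => projEntry v.1) (by
  rintro ⟨a, ha⟩ ⟨b, hb⟩ t h
  simp only at h ⊢
  subst h
  exact projEntry_smul (fun h => ha (by simp [h])) b)

lemma continuous_projMat : Continuous projMat := continuous_quot_lift _ continuous_projEntry

lemma projMat_mkP {v : Fin 3 → ℂ} (hv : v ≠ 0) : projMat (mkP v) = projEntry v := by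
  rw [mkP_of_ne hv]; rfl

instance : T2Space P2 := by
  refine T2Space.of_injective_continuous (f := projMat) ?_ continuous_projMat
  intro p q hpq
  obtain ⟨v, hv, rfl⟩ := exists_mkP p
  obtain ⟨w, hw, rfl⟩ := exists_mkP q
  rw [eq_comm, mkP_eq_iff hw hv]
  apply smul_eq_of_projEntry_eq hv hw
  simpa [projMat_mkP hv, projMat_mkP hw] using hpq

/-- The vector `v` lies on the line represented by `p`. -/
def OnLine (v : Fin 3 → ℂ) (p : P2) : Prop := ∀ r, ∑ s, projMat p r s * v s = v r

lemma onLine_mkP {v w : Fin 3 → ℂ} (hw : w ≠ 0) : OnLine v (mkP w) ↔ ∃ a : ℂ, v = a • w := by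
  have hs := sum_mul_star_ne_zero hw
  simp only [OnLine, projMat_mkP hw, projEntry]
  constructor
  · intro h
    refine ⟨(∑ s, star (w s) * v s) / ∑ k, w k * star (w k), ?_⟩
    funext r
    rw [← h r, Pi.smul_apply, smul_eq_mul, Finset.sum_div, Finset.sum_mul]
    exact Finset.sum_congr rfl fun s _ => by ring
  · rintro ⟨a, rfl⟩ r
    simp only [Pi.smul_apply, smul_eq_mul]
    rw [Finset.sum_congr rfl fun s _ => show w r * star (w s) / (∑ k, w k * star (w k)) * (a * w s)
      = (a * w r / ∑ k, w k * star (w k)) * (w s * star (w s)) by ring, ← Finset.mul_sum]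
    field_simp

lemma isClosed_onLine : IsClosed {q : (Fin 3 → ℂ) × P2 | OnLine q.1 q.2} := by
  simp only [OnLine, Set.ofPred_forall]
  refine isClosed_iInter fun r => isClosed_eq ?_ ?_
  · refine continuous_finsetSum _ fun s _ => Continuous.mul ?_ ?_
    · exact (continuous_apply s).comp ((continuous_apply r).comp
        (continuous_projMat.comp continuous_snd))
    · exact (continuous_apply s).comp continuous_fst
  · exact (continuous_apply r).comp continuous_fst

/-! Camera configurations in general position, and the points of the divisor at infinity. -/

/-- Cameras `A i` with centres `c i`, and linear forms `l i` cutting out the preimages of the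
lines at infinity, in general position. -/
structure CameraConfig (n : ℕ) where
  A : Fin n → Matrix (Fin 3) (Fin 4) ℂ
  Cs : Fin n → Matrix (Fin 3) (Fin 3) ℂ
  c : Fin n → Fin 4 → ℂ
  l : Fin n → (Fin 4 → ℂ) →ₗ[ℂ] ℂ
  three_le : 3 ≤ n
  c_ne : ∀ i, c i ≠ 0
  mulVec_eq_zero : ∀ i x, (A i).mulVec x = 0 ↔ ∃ a : ℂ, x = a • c i
  surj : ∀ i v, ∃ x, (A i).mulVec x = v
  l_c : ∀ i, l i (c i) = 0
  l_c_ne : ∀ i j, i ≠ j → l i (c j) ≠ 0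
  ind3 : ∀ f : Fin 3 → Fin n, Function.Injective f → LinearIndependent ℂ (l ∘ f)
  ind4 : ∀ f : Fin 4 → Fin n, Function.Injective f → LinearIndependent ℂ (l ∘ f)
  inf_iff : ∀ i x, (A i).mulVec x ≠ 0 → (mkP ((A i).mulVec x) ∈ infLine (Cs i) ↔ l i x = 0)

namespace CameraConfig

variable {n : ℕ} (K : CameraConfig n)

lemma exists_ne (K : CameraConfig n) (i : Fin n) : ∃ j, j ≠ i := by
  have := K.three_le
  have : Nontrivial (Fin n) := Fin.nontrivial_iff_two_le.2 (by omega)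
  exact _root_.exists_ne i

lemma exists_ne₂ (K : CameraConfig n) (i i' : Fin n) : ∃ j, j ≠ i ∧ j ≠ i' := by
  have h3 := K.three_le
  by_contra! h
  have : (Finset.univ : Finset (Fin n)) ⊆ {i, i'} := fun j _ => by
    by_cases hj : j = i
    · simp [hj]
    · simp [h j hj]
  have := (Finset.card_le_card this).trans Finset.card_le_two
  simp at this
  omega

/-- The tuple of images of `x`, with the `i`-th image replaced by that of `w`. -/
def pt (i : Fin n) (x w : Fin 4 → ℂ) : Fin n → P2 :=
  fun j => mkP ((K.A j).mulVec (if j = i then w else x))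

/-- `x` is a point of the plane `l i = 0` and `w` gives a line through `c i` and `x`
inside this plane. -/
structure Valid (i : Fin n) (x w : Fin 4 → ℂ) : Prop where
  ne : x ≠ 0
  lx : K.l i x = 0
  lw : K.l i w = 0
  Aw : (K.A i).mulVec w ≠ 0
  line : ∃ a b : ℂ, x = a • K.c i + b • w

variable {K} {i i' j : Fin n} {x x' w w' : Fin 4 → ℂ}

@[simp] lemma A_c : (K.A i).mulVec (K.c i) = 0 := (K.mulVec_eq_zero i _).2 ⟨1, by simp⟩

lemma eq_zero_of_mulVec (hx : K.l i x = 0) (hj : j ≠ i) (h : (K.A j).mulVec x = 0) : x = 0 := by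
  obtain ⟨a, rfl⟩ := (K.mulVec_eq_zero j x).1 h
  rw [map_smul, smul_eq_zero] at hx
  rcases hx with rfl | hx
  · simp
  · exact absurd hx (K.l_c_ne i j hj.symm)

lemma Valid.A_ne (h : K.Valid i x w) (hj : j ≠ i) : (K.A j).mulVec x ≠ 0 :=
  fun h0 => h.ne (eq_zero_of_mulVec h.lx hj h0)

lemma Valid.A_ne_ite (h : K.Valid i x w) :
    (K.A j).mulVec (if j = i then w else x) ≠ 0 := by
  split_ifs with hj
  · subst hj; exact h.Aw
  · exact h.A_ne hj

lemma Valid.pt_mem_infLine (h : K.Valid i x w) :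
    K.pt i x w j ∈ infLine (K.Cs j) ↔ K.l j x = 0 := by
  rw [pt, K.inf_iff j _ h.A_ne_ite]
  split_ifs with hj
  · subst hj; simp [h.lx, h.lw]
  · rfl

/-- A nonzero point of a plane at infinity away from the centre determines a valid pair. -/
lemma valid_self (hl : K.l i x = 0) (hA : (K.A i).mulVec x ≠ 0) : K.Valid i x x :=
  ⟨fun h => hA (by simp [h]), hl, hl, hA, 0, 1, by simp⟩

lemma pt_self (i i' : Fin n) (x : Fin 4 → ℂ) : K.pt i x x = K.pt i' x x := by
  funext j; simp [pt]

lemma mkP_A_eq_iff (hx : (K.A j).mulVec x ≠ 0) (hx' : (K.A j).mulVec x' ≠ 0) :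
    mkP ((K.A j).mulVec x) = mkP ((K.A j).mulVec x') ↔
      ∃ μ a : ℂ, μ ≠ 0 ∧ x' = μ • x + a • K.c j := by
  rw [mkP_eq_iff hx hx']
  constructor
  · rintro ⟨μ, h⟩
    have : (K.A j).mulVec (x' - μ • x) = 0 := by
      rw [Matrix.mulVec_sub, Matrix.mulVec_smul, h, sub_self]
    obtain ⟨a, ha⟩ := (K.mulVec_eq_zero j _).1 this
    refine ⟨μ, a, ?_, by rw [← ha]; abel⟩
    rintro rfl
    exact hx' (by simpa using h)
  · rintro ⟨μ, a, -, rfl⟩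
    exact ⟨μ, by simp [Matrix.mulVec_add, Matrix.mulVec_smul]⟩

lemma pt_eq_pt (h : K.Valid i x w) (h' : K.Valid i x' w') :
    K.pt i x w = K.pt i x' w' ↔
      (∃ μ : ℂ, μ ≠ 0 ∧ x' = μ • x) ∧ ∃ ν a : ℂ, ν ≠ 0 ∧ w' = ν • w + a • K.c i := by
  constructor
  · intro e
    refine ⟨?_, ?_⟩
    · obtain ⟨j, hj⟩ := K.exists_ne i
      have ej := congrFun e j
      simp only [pt, hj, if_false] at ej
      obtain ⟨μ, a, hμ, rfl⟩ := (mkP_A_eq_iff (h.A_ne hj) (h'.A_ne hj)).1 ej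
      refine ⟨μ, hμ, ?_⟩
      have := h'.lx
      simp only [map_add, map_smul, h.lx, mul_zero, zero_add, smul_eq_mul, mul_eq_zero,
        K.l_c_ne i j hj.symm, or_false] at this
      simp [this]
    · have ei := congrFun e i
      simp only [pt, if_true] at ei
      exact (mkP_A_eq_iff h.Aw h'.Aw).1 ei
  · rintro ⟨⟨μ, hμ, rfl⟩, ν, a, hν, rfl⟩
    funext j
    by_cases hj : j = i
    · subst hj
      simp only [pt, if_true]
      exact (mkP_A_eq_iff h.Aw h'.Aw).2 ⟨ν, a, hν, rfl⟩
    · simp only [pt, hj, if_false]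
      rw [Matrix.mulVec_smul, mkP_smul hμ]

lemma Valid.pt_eq_self (h : K.Valid i x w) (hA : (K.A i).mulVec x ≠ 0) :
    K.pt i x w = K.pt i x x := by
  obtain ⟨a, b, hx⟩ := h.line
  refine (pt_eq_pt h (valid_self h.lx hA)).2 ⟨⟨1, one_ne_zero, by simp⟩, b, a, ?_, ?_⟩
  · rintro rfl
    exact hA (by simp [hx, Matrix.mulVec_smul])
  · rw [add_comm]; exact hx

lemma pt_eq_pt_of_ne (hne : i ≠ i') (h : K.Valid i x w) (h' : K.Valid i' x' w') :
    K.pt i x w = K.pt i' x' w' ↔ ∃ μ : ℂ, μ ≠ 0 ∧ x' = μ • x := by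
  constructor
  · intro e
    obtain ⟨j, hj, hj'⟩ := K.exists_ne₂ i i'
    have ej := congrFun e j
    simp only [pt, hj, hj', if_false] at ej
    obtain ⟨μ, a, hμ, hx'⟩ := (mkP_A_eq_iff (h.A_ne hj) (h'.A_ne hj')).1 ej
    refine ⟨μ, hμ, ?_⟩
    have ei := congrFun e i
    simp only [pt, if_true, hne, if_false] at ei
    obtain ⟨ν, b, -, hν⟩ := (mkP_A_eq_iff h.Aw (h'.A_ne hne)).1 ei
    have : K.l i x' = 0 := by simp [hν, h.lw, K.l_c]
    rw [hx'] at this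
    simp only [map_add, map_smul, h.lx, mul_zero, zero_add, smul_eq_mul, mul_eq_zero,
      K.l_c_ne i j hj.symm, or_false] at this
    simp [hx', this]
  · rintro ⟨μ, hμ, rfl⟩
    have hl : K.l i' x = 0 := by
      have := h'.lx
      simpa [hμ] using this
    have hA : (K.A i).mulVec x ≠ 0 := fun h0 => h.ne (eq_zero_of_mulVec hl hne h0)
    have hA' : (K.A i').mulVec (μ • x) ≠ 0 := fun h0 =>
      h'.ne (eq_zero_of_mulVec (i := i) (by simp [h.lx]) hne.symm h0)
    rw [h.pt_eq_self hA, h'.pt_eq_self hA']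
    funext j
    simp [pt, Matrix.mulVec_smul, mkP_smul hμ]

lemma exists_smul_of_pt_eq (h : K.Valid i x w) (h' : K.Valid i' x' w')
    (e : K.pt i x w = K.pt i' x' w') : ∃ μ : ℂ, μ ≠ 0 ∧ x' = μ • x := by
  by_cases hne : i = i'
  · subst hne
    exact ((pt_eq_pt h h').1 e).1
  · exact (pt_eq_pt_of_ne hne h h').1 e

/-- The multiview variety sits inside the closed set of tuples of lines containing the images
of a common point. -/
lemma exists_onLine_of_mem_mvVariety {P : Fin n → P2} (hP : P ∈ mvVariety K.A) :
    ∃ x : Fin 4 → ℂ, x ≠ 0 ∧ ∀ j, OnLine ((K.A j).mulVec x) (P j) := by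
  let R : Set (↥(Metric.sphere (0 : Fin 4 → ℂ) 1) × (Fin n → P2)) :=
    {q | ∀ j, OnLine ((K.A j).mulVec q.1.1) (q.2 j)}
  have hR : IsClosed R := by
    have : R = ⋂ j, (fun q : ↥(Metric.sphere (0 : Fin 4 → ℂ) 1) × (Fin n → P2) =>
        ((K.A j).mulVec q.1.1, q.2 j)) ⁻¹' {q | OnLine q.1 q.2} := by
      ext q; simp [R]
    rw [this]
    refine isClosed_iInter fun j => isClosed_onLine.preimage ?_
    refine Continuous.prodMk ?_ ((continuous_apply j).comp continuous_snd)
    exact (Continuous.matrix_mulVec continuous_const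
      (continuous_subtype_val.comp continuous_fst))
  have hcl : IsClosed (Prod.snd '' R) := isClosedMap_snd_of_compactSpace _ hR
  have hsub : mvVariety K.A ⊆ Prod.snd '' R := by
    refine closure_minimal ?_ hcl
    rintro P ⟨y, hy, hA, hPy⟩
    have hny : (‖y‖ : ℂ) ≠ 0 := by simpa using hy
    refine ⟨(⟨(‖y‖ : ℂ)⁻¹ • y, by simp [norm_smul, hy]⟩, P), ?_, rfl⟩
    intro j
    simp only
    rw [hPy j, onLine_mkP (hA j)]
    exact ⟨(‖y‖ : ℂ)⁻¹, by rw [Matrix.mulVec_smul]⟩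
  obtain ⟨⟨x, P'⟩, hx, rfl⟩ := hsub hP
  exact ⟨x.1, fun h => by simpa [h] using x.2, hx⟩

lemma Valid.pt_mem_mvVariety (h : K.Valid i x w) : K.pt i x w ∈ mvVariety K.A := by
  by_cases hA : (K.A i).mulVec x = 0
  · obtain ⟨a, rfl⟩ := (K.mulVec_eq_zero i x).1 hA
    have ha : a ≠ 0 := fun h0 => h.ne (by simp [h0])
    have hcont : ∀ j, j ≠ i → ContinuousAt
        (fun t : ℂ => mkP ((K.A j).mulVec (a • K.c i + t • w))) 0 := by
      intro j hj
      refine ContinuousAt.comp (g := mkP) (f := fun t : ℂ => (K.A j).mulVec (a • K.c i + t • w))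
        (continuousAt_mkP ?_) ?_
      · simpa using h.A_ne hj
      · exact (Continuous.matrix_mulVec continuous_const (by fun_prop)).continuousAt
    have hlim : Tendsto (fun t : ℂ => K.pt i (a • K.c i + t • w) w) (𝓝[≠] 0)
        (𝓝 (K.pt i (a • K.c i) w)) := by
      refine tendsto_pi_nhds.2 fun j => ?_
      by_cases hj : j = i
      · simp [pt, hj]
      · have := (hcont j hj).tendsto
        simp only [zero_smul, add_zero] at this
        simpa [pt, hj] using this.mono_left nhdsWithin_le_nhds
    refine mem_closure_of_tendsto hlim ?_
    filter_upwards [self_mem_nhdsWithin] with t ht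
    have ht : t ≠ 0 := ht
    have hAy : (K.A i).mulVec (a • K.c i + t • w) ≠ 0 := by
      simp [Matrix.mulVec_add, Matrix.mulVec_smul, ht, h.Aw]
    have hl : K.l i (a • K.c i + t • w) = 0 := by simp [h.lw, K.l_c]
    have hV : K.Valid i (a • K.c i + t • w) w :=
      ⟨fun h0 => hAy (by simp [h0]), hl, h.lw, h.Aw, a, t, rfl⟩
    rw [hV.pt_eq_self hAy]
    refine ⟨_, hV.ne, fun j => ?_, fun j => by simp [pt]⟩
    by_cases hj : j = i
    · subst hj; exact hAy
    · exact hV.A_ne hj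
  · rw [h.pt_eq_self hA]
    refine subset_closure ⟨x, h.ne, fun j => ?_, fun j => by simp [pt]⟩
    by_cases hj : j = i
    · subst hj; exact hA
    · exact h.A_ne hj

lemma mem_Dinf_iff {P : Fin n → P2} :
    P ∈ Dinf K.A K.Cs i ↔ ∃ x w, K.Valid i x w ∧ P = K.pt i x w := by
  constructor
  · rintro ⟨hP, hinf⟩
    obtain ⟨x, hx, hon⟩ := exists_onLine_of_mem_mvVariety hP
    obtain ⟨v, hv, hPv⟩ := exists_mkP (P i)
    obtain ⟨w, rfl⟩ := K.surj i v
    have hlw : K.l i w = 0 := by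
      have : P i ∈ infLine (K.Cs i) := hinf
      rw [hPv] at this
      exact (K.inf_iff i w hv).1 this
    have hi := hon i
    rw [hPv, onLine_mkP hv] at hi
    obtain ⟨b, hb⟩ := hi
    have : (K.A i).mulVec (x - b • w) = 0 := by
      rw [Matrix.mulVec_sub, Matrix.mulVec_smul, hb, sub_self]
    obtain ⟨a, ha⟩ := (K.mulVec_eq_zero i _).1 this
    have hxw : x = a • K.c i + b • w := by rw [← ha]; abel
    have hV : K.Valid i x w := ⟨hx, by simp [hxw, hlw, K.l_c], hlw, hv, a, b, hxw⟩
    refine ⟨x, w, hV, ?_⟩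
    funext j
    by_cases hj : j = i
    · subst hj; simpa [pt] using hPv
    · obtain ⟨u, hu, hPu⟩ := exists_mkP (P j)
      have hj' := hon j
      rw [hPu, onLine_mkP hu] at hj'
      simp only [pt, hj, if_false]
      rw [hPu, mkP_eq_iff hu (hV.A_ne hj)]
      exact hj'
  · rintro ⟨x, w, h, rfl⟩
    exact ⟨h.pt_mem_mvVariety, h.pt_mem_infLine.2 h.lx⟩

lemma DinfAll_eq : DinfAll K.A K.Cs = ⋃ i, Dinf K.A K.Cs i := by
  simp only [DinfAll, Dinf, Set.inter_iUnion]

lemma Valid.pt_mem_Dinf (h : K.Valid i x w) : K.pt i x w ∈ Dinf K.A K.Cs j ↔ K.l j x = 0 :=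
  ⟨fun hh => h.pt_mem_infLine.1 hh.2, fun hl => ⟨h.pt_mem_mvVariety, h.pt_mem_infLine.2 hl⟩⟩

end CameraConfig

/-! Linear algebra of the forms cutting out the planes at infinity. -/

lemma pi_surjective_of_linearIndependent {m : ℕ} {E : Type*} [AddCommGroup E] [Module ℂ E]
    {f : Fin m → E →ₗ[ℂ] ℂ} (hf : LinearIndependent ℂ f) :
    Function.Surjective (LinearMap.pi f) := by
  rw [← LinearMap.dualMap_injective_iff, injective_iff_map_eq_zero]
  intro φ hφ
  have hsum : ∑ k, φ (Pi.single k 1) • f k = 0 := by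
    ext x
    have := LinearMap.congr_fun hφ x
    simp only [LinearMap.dualMap_apply, LinearMap.zero_apply] at this
    rw [← LinearMap.sum_single_apply (fun _ => ℂ) (LinearMap.pi f x), map_sum] at this
    simp only [LinearMap.sum_apply, LinearMap.smul_apply, smul_eq_mul, LinearMap.zero_apply]
    rw [← this]
    refine Finset.sum_congr rfl fun k _ => ?_
    have h1 : (LinearMap.single ℂ (fun _ : Fin m => ℂ) k) (LinearMap.pi f x k)
        = f k x • (Pi.single k 1 : Fin m → ℂ) := by
      ext j
      by_cases hj : j = k
      · subst hj; simp
      · simp [hj]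
    simp only [LinearMap.single_apply] at h1
    rw [h1, map_smul, smul_eq_mul, mul_comm]
  have := Fintype.linearIndependent_iff.1 hf _ hsum
  refine LinearMap.pi_ext' fun k => ?_
  ext
  simpa using this k

/-- The kernel of `m` independent forms on `ℂ⁴` has a basis of `4 - m` vectors. -/
lemma exists_kernel_param {m r : ℕ} {f : Fin m → (Fin 4 → ℂ) →ₗ[ℂ] ℂ}
    (hf : LinearIndependent ℂ f) (hr : m + r = 4) :
    ∃ B : (Fin r → ℂ) →ₗ[ℂ] (Fin 4 → ℂ), Function.Injective B ∧
      ∀ x, (∀ k, f k x = 0) ↔ ∃ w, x = B w := by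
  have hs := LinearMap.range_eq_top.2 (pi_surjective_of_linearIndependent hf)
  have hrk := LinearMap.finrank_range_add_finrank_ker (LinearMap.pi f)
  rw [hs, finrank_top, Module.finrank_fin_fun, Module.finrank_fin_fun] at hrk
  let e : (Fin r → ℂ) ≃ₗ[ℂ] LinearMap.ker (LinearMap.pi f) :=
    LinearEquiv.ofFinrankEq _ _ (by rw [Module.finrank_fin_fun]; omega)
  refine ⟨(LinearMap.ker (LinearMap.pi f)).subtype ∘ₗ e.toLinearMap,
    Subtype.val_injective.comp e.injective, fun x => ⟨fun h => ?_, ?_⟩⟩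
  · refine ⟨e.symm ⟨x, ?_⟩, by simp⟩
    rw [LinearMap.mem_ker]
    funext k
    exact h k
  · rintro ⟨w, rfl⟩ k
    exact congrFun (LinearMap.mem_ker.1 (e w).2) k

namespace CameraConfig

variable {n : ℕ} (K : CameraConfig n)

lemma linearIndependent_pair {i j : Fin n} (h : i ≠ j) :
    LinearIndependent ℂ ![K.l i, K.l j] := by
  obtain ⟨k, hki, hkj⟩ := K.exists_ne₂ i j
  have h3 := K.ind3 ![i, j, k] (by
    intro a b hab
    fin_cases a <;> fin_cases b <;> simp_all [eq_comm])
  have := h3.comp ![(0 : Fin 3), 1] (by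
    intro a b hab
    fin_cases a <;> fin_cases b <;> simp_all)
  convert this using 1
  funext a
  fin_cases a <;> rfl

/-- A basis of the line `l i = l j = 0`. -/
lemma exists_line_param {i j : Fin n} (h : i ≠ j) :
    ∃ B : (Fin 2 → ℂ) →ₗ[ℂ] (Fin 4 → ℂ), Function.Injective B ∧
      ∀ x, (K.l i x = 0 ∧ K.l j x = 0) ↔ ∃ w, x = B w := by
  obtain ⟨B, hB, h⟩ := exists_kernel_param (r := 2) (K.linearIndependent_pair h) rfl
  exact ⟨B, hB, fun x => by rw [← h x]; simp [Fin.forall_fin_two]⟩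

/-- Three of the planes at infinity meet in exactly one point. -/
lemma exists_triple_point {i j k : Fin n} (hij : i ≠ j) (hik : i ≠ k) (hjk : j ≠ k) :
    ∃ p : Fin 4 → ℂ, p ≠ 0 ∧
      ∀ x, (K.l i x = 0 ∧ K.l j x = 0 ∧ K.l k x = 0) ↔ ∃ a : ℂ, x = a • p := by
  have h3 := K.ind3 ![i, j, k] (by
    intro a b hab
    fin_cases a <;> fin_cases b <;> simp_all [eq_comm])
  obtain ⟨B, hB, h⟩ := exists_kernel_param (r := 1) h3 rfl
  refine ⟨B fun _ => 1, fun h0 => ?_, fun x => ?_⟩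
  · have := hB (h0.trans (map_zero B).symm)
    simpa using congrFun this 0
  · have := h x
    simp only [Fin.forall_fin_succ, Function.comp] at this
    simp only [Matrix.cons_val_zero, Matrix.cons_val_succ, IsEmpty.forall_iff, and_true] at this
    rw [this]
    constructor
    · rintro ⟨w, rfl⟩
      refine ⟨w 0, ?_⟩
      rw [← map_smul]
      congr 1
      funext a
      simp [Subsingleton.elim a 0]
    · rintro ⟨a, rfl⟩
      exact ⟨a • fun _ => 1, by rw [map_smul]⟩

lemma injective_of_card_four {f : Fin 4 → Fin n} (hf : Function.Injective f) :
    Function.Injective (LinearMap.pi (K.l ∘ f)) := by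
  obtain ⟨B, -, h⟩ := exists_kernel_param (r := 0) (K.ind4 f hf) rfl
  refine (injective_iff_map_eq_zero _).2 fun x hx => ?_
  obtain ⟨w, rfl⟩ := (h x).1 fun k => congrFun hx k
  rw [Subsingleton.elim w 0, map_zero]

lemma exists_dual {S : Finset (Fin n)} (hS : S.card = 3) (j : Fin n) :
    ∃ v : Fin 4 → ℂ, ∀ k ∈ S, K.l k v = if k = j then 1 else 0 := by
  let e : Fin 3 ≃ S := (Finset.equivFinOfCardEq hS).symm
  have hinj : Function.Injective fun a => (e a : Fin n) := Subtype.val_injective.comp e.injective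
  obtain ⟨v, hv⟩ := pi_surjective_of_linearIndependent (K.ind3 _ hinj)
    fun a => if (e a : Fin n) = j then 1 else 0
  refine ⟨v, fun k hk => ?_⟩
  have := congrFun hv (e.symm ⟨k, hk⟩)
  simpa using this

end CameraConfig

/-! A displacement field on `ℂ⁴` moving points near the planes at infinity onto them. -/

namespace CameraConfig

variable {n : ℕ}

/-- The vector field `Δ` snaps every point onto the planes whose weight `lam` is nonzero. -/
structure Snap (K : CameraConfig n) where
  Δ : (Fin 4 → ℂ) → Fin 4 → ℂ
  lam : (Fin 4 → ℂ) → Fin n → ℝ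
  continuousAt_Δ : ∀ x, x ≠ 0 → ContinuousAt Δ x
  continuousAt_lam : ∀ i x, x ≠ 0 → K.l i x = 0 → ContinuousAt lam x
  Δ_smul : ∀ (μ : ℂ) x, μ ≠ 0 → Δ (μ • x) = μ • Δ x
  lam_smul : ∀ (μ : ℂ) x, μ ≠ 0 → lam (μ • x) = lam x
  sub_ne : ∀ x, x ≠ 0 → ∀ t ∈ Set.Icc (0 : ℝ) 1, x - (t : ℂ) • Δ x ≠ 0
  l_Δ : ∀ i x, x ≠ 0 → K.l i x = 0 → K.l i (Δ x) = 0
  A_ne : ∀ i x, x ≠ 0 → K.l i x = 0 → Δ x ≠ 0 → ∀ t ∈ Set.Icc (0 : ℝ) 1,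
    (K.A i).mulVec (x - (t : ℂ) • Δ x) ≠ 0
  eventually_zero : ∀ i (s : ℂ), s ≠ 0 → ∀ᶠ x in 𝓝 (s • K.c i), K.l i x = 0 → Δ x = 0
  lam_mem : ∀ i x, x ≠ 0 → K.l i x = 0 → lam x ∈ stdSimplex ℝ (Fin n)
  snap : ∀ i x, x ≠ 0 → lam x i ≠ 0 → K.l i (x - Δ x) = 0

variable (K : CameraConfig n)

/-- The relative distance of `x` to the plane `l j = 0`. -/
def relDist (j : Fin n) (x : Fin 4 → ℂ) : ℝ := ‖K.l j x‖ / ‖x‖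

/-- A cutoff equal to `1` for `relDist ≤ e` and to `0` for `relDist ≥ 2 e`. -/
def cutoff (e : ℝ) (j : Fin n) (x : Fin 4 → ℂ) : ℝ := max 0 (min 1 (2 - K.relDist j x / e))

/-- A weight supported where all planes not in `S` are at distance more than `2 e`. -/
def tripleWeight (e : ℝ) (S : Finset (Fin n)) (x : Fin 4 → ℂ) : ℝ :=
  ∏ j ∈ Sᶜ, max 0 (K.relDist j x - 2 * e)

/-- Sets of three planes. -/
abbrev triples (n : ℕ) : Finset (Finset (Fin n)) := Finset.powersetCard 3 Finset.univ

/-- The averaged dual vectors. -/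
def dualField (v : Finset (Fin n) → Fin n → Fin 4 → ℂ) (e : ℝ) (j : Fin n) (x : Fin 4 → ℂ) :
    Fin 4 → ℂ :=
  (∑ S ∈ triples n, K.tripleWeight e S x)⁻¹ • ∑ S ∈ triples n, K.tripleWeight e S x • v S j

/-- The displacement field. -/
def snapField (v : Finset (Fin n) → Fin n → Fin 4 → ℂ) (e : ℝ) (x : Fin 4 → ℂ) : Fin 4 → ℂ :=
  ∑ j, ((K.cutoff e j x : ℂ) * K.l j x) • K.dualField v e j x

variable {K} {e : ℝ} {x : Fin 4 → ℂ} {j : Fin n} {v : Finset (Fin n) → Fin n → Fin 4 → ℂ}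

lemma relDist_smul {μ : ℂ} (hμ : μ ≠ 0) : K.relDist j (μ • x) = K.relDist j x := by
  rw [relDist, relDist, map_smul, norm_smul, norm_smul]
  exact mul_div_mul_left _ _ (norm_ne_zero_iff.2 hμ)

lemma relDist_nonneg : 0 ≤ K.relDist j x := by unfold relDist; positivity

lemma continuous_l : Continuous (K.l j) := LinearMap.continuous_of_finiteDimensional _

lemma continuousAt_relDist (hx : x ≠ 0) : ContinuousAt (K.relDist j) x :=
  (continuous_l.norm.continuousAt).div continuous_norm.continuousAt (norm_ne_zero_iff.2 hx)

lemma norm_l_eq (hx : x ≠ 0) : ‖K.l j x‖ = K.relDist j x * ‖x‖ := by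
  rw [relDist, div_mul_cancel₀ _ (norm_ne_zero_iff.2 hx)]

lemma cutoff_nonneg : 0 ≤ K.cutoff e j x := le_max_left _ _

lemma cutoff_le_one : K.cutoff e j x ≤ 1 := max_le zero_le_one (min_le_left _ _)

lemma cutoff_eq_one (he : 0 < e) (h : K.relDist j x ≤ e) : K.cutoff e j x = 1 := by
  have : K.relDist j x / e ≤ 1 := (div_le_one he).2 h
  rw [cutoff, min_eq_left (by linarith), max_eq_right zero_le_one]

lemma cutoff_eq_zero (he : 0 < e) (h : 2 * e ≤ K.relDist j x) : K.cutoff e j x = 0 := by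
  have : 2 ≤ K.relDist j x / e := (le_div_iff₀ he).2 h
  exact max_eq_left ((min_le_right _ _).trans (by linarith))

lemma continuousAt_cutoff (hx : x ≠ 0) : ContinuousAt (K.cutoff e j) x :=
  Filter.Tendsto.max continuousAt_const (Filter.Tendsto.min continuousAt_const
    (continuousAt_const.sub ((continuousAt_relDist hx).div_const e)))

lemma tripleWeight_nonneg (S : Finset (Fin n)) : 0 ≤ K.tripleWeight e S x :=
  Finset.prod_nonneg fun _ _ => le_max_left _ _

lemma mem_of_tripleWeight_ne {S : Finset (Fin n)} (h : K.tripleWeight e S x ≠ 0)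
    (hj : K.relDist j x ≤ 2 * e) : j ∈ S := by
  by_contra hS
  exact h (Finset.prod_eq_zero (Finset.mem_compl.2 hS) (max_eq_left (by linarith)))

lemma continuousAt_tripleWeight (hx : x ≠ 0) (S : Finset (Fin n)) :
    ContinuousAt (K.tripleWeight e S) x := by
  unfold tripleWeight
  refine tendsto_finsetProd _ fun j _ => ?_
  exact Filter.Tendsto.max continuousAt_const ((continuousAt_relDist hx).sub continuousAt_const)

/-- No point is within distance `2 e` of four planes. -/
def FourApart (K : CameraConfig n) (e : ℝ) : Prop :=
  ∀ f : Fin 4 → Fin n, Function.Injective f → ∀ x, x ≠ 0 → ∃ k, 2 * e < K.relDist (f k) x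

lemma sum_tripleWeight_pos (he : K.FourApart e) (hx : x ≠ 0) :
    0 < ∑ S ∈ triples n, K.tripleWeight e S x := by
  let T : Finset (Fin n) := Finset.univ.filter fun j => K.relDist j x ≤ 2 * e
  have hT : T.card ≤ 3 := by
    by_contra! h
    obtain ⟨T', hT', hc⟩ := Finset.exists_subset_card_eq (show 4 ≤ T.card from h)
    let g : Fin 4 ≃ T' := (Finset.equivFinOfCardEq hc).symm
    obtain ⟨k, hk⟩ := he (fun a => g a) (Subtype.val_injective.comp g.injective) x hx
    have := (Finset.mem_filter.1 (hT' (g k).2)).2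
    linarith
  obtain ⟨S, hTS, hS⟩ := Finset.exists_superset_card_eq hT (by simpa using K.three_le)
  refine Finset.sum_pos' (fun S _ => tripleWeight_nonneg S)
    ⟨S, Finset.mem_powersetCard.2 ⟨Finset.subset_univ _, hS⟩, ?_⟩
  refine Finset.prod_pos fun j hj => lt_max_of_lt_right ?_
  by_contra! h
  exact Finset.mem_compl.1 hj (hTS (Finset.mem_filter.2 ⟨Finset.mem_univ _, by linarith⟩))

lemma continuousAt_snapField (he : K.FourApart e) (hx : x ≠ 0) :
    ContinuousAt (K.snapField v e) x := by
  unfold snapField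
  refine tendsto_finsetSum _ fun j _ => Filter.Tendsto.smul ?_ ?_
  · exact (Complex.continuous_ofReal.continuousAt.comp (continuousAt_cutoff hx)).mul
      continuous_l.continuousAt
  · unfold dualField
    refine Filter.Tendsto.smul (Filter.Tendsto.inv₀ ?_ (sum_tripleWeight_pos he hx).ne') ?_
    · exact tendsto_finsetSum _ fun S _ => continuousAt_tripleWeight hx S
    · exact tendsto_finsetSum _ fun S _ => (continuousAt_tripleWeight hx S).smul
        continuousAt_const

lemma snapField_smul {μ : ℂ} (hμ : μ ≠ 0) : K.snapField v e (μ • x) = μ • K.snapField v e x := by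
  simp only [snapField, dualField, cutoff, tripleWeight, relDist_smul hμ, map_smul,
    Finset.smul_sum, smul_smul, smul_eq_mul]
  refine Finset.sum_congr rfl fun j _ => Finset.sum_congr rfl fun S _ => ?_
  simp only [← Complex.coe_smul, smul_smul]
  congr 1
  ring

lemma l_dualField (he : K.FourApart e) (hx : x ≠ 0)
    (hv : ∀ S : Finset (Fin n), S.card = 3 → ∀ j, ∀ k ∈ S, K.l k (v S j) = if k = j then 1 else 0)
    {k : Fin n} (hk : K.relDist k x ≤ 2 * e) :
    K.l k (K.dualField v e j x) = if k = j then 1 else 0 := by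
  have hsum : K.l k (∑ S ∈ triples n, K.tripleWeight e S x • v S j) =
      ((∑ S ∈ triples n, K.tripleWeight e S x : ℝ) : ℂ) * if k = j then 1 else 0 := by
    rw [map_sum, Complex.ofReal_sum, Finset.sum_mul]
    refine Finset.sum_congr rfl fun S hS => ?_
    rw [← Complex.coe_smul, map_smul, smul_eq_mul]
    by_cases h0 : K.tripleWeight e S x = 0
    · simp [h0]
    · rw [hv S (Finset.mem_powersetCard.1 hS).2 j k (mem_of_tripleWeight_ne h0 hk)]
  rw [dualField, ← Complex.coe_smul, map_smul, hsum, smul_eq_mul, ← mul_assoc,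
    Complex.ofReal_inv, inv_mul_cancel₀, one_mul]
  exact_mod_cast (sum_tripleWeight_pos he hx).ne'

lemma l_snapField (he : K.FourApart e) (hx : x ≠ 0)
    (hv : ∀ S : Finset (Fin n), S.card = 3 → ∀ j, ∀ k ∈ S, K.l k (v S j) = if k = j then 1 else 0)
    {k : Fin n} (hk : K.relDist k x ≤ 2 * e) :
    K.l k (K.snapField v e x) = K.cutoff e k x * K.l k x := by
  rw [snapField, map_sum, Finset.sum_eq_single k]
  · rw [map_smul, l_dualField he hx hv hk]; simp
  · intro j _ hj
    rw [map_smul, l_dualField he hx hv hk]; simp [hj.symm]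
  · simp

lemma norm_dualField_le (he : K.FourApart e) (hx : x ≠ 0) {M : ℝ} (hM : ∀ S j, ‖v S j‖ ≤ M) :
    ‖K.dualField v e j x‖ ≤ M := by
  have hpos := sum_tripleWeight_pos he hx
  rw [dualField, norm_smul, norm_inv, Real.norm_of_nonneg hpos.le, inv_mul_le_iff₀ hpos,
    Finset.sum_mul]
  refine norm_sum_le_of_le _ fun S _ => ?_
  rw [norm_smul, Real.norm_of_nonneg (tripleWeight_nonneg S)]
  exact mul_le_mul_of_nonneg_left (hM S j) (tripleWeight_nonneg S)

lemma norm_snapField_le (he0 : 0 < e) (he : K.FourApart e) (hx : x ≠ 0) {M : ℝ} (hM0 : 0 ≤ M)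
    (hM : ∀ S j, ‖v S j‖ ≤ M) : ‖K.snapField v e x‖ ≤ (n * (2 * e * M)) * ‖x‖ := by
  have : ∀ j ∈ (Finset.univ : Finset (Fin n)),
      ‖((K.cutoff e j x : ℂ) * K.l j x) • K.dualField v e j x‖ ≤ 2 * e * M * ‖x‖ := by
    intro j _
    rw [norm_smul, norm_mul, Complex.norm_real, Real.norm_of_nonneg cutoff_nonneg]
    rcases le_or_gt (2 * e) (K.relDist j x) with h | h
    · rw [cutoff_eq_zero he0 h, zero_mul, zero_mul]
      positivity
    · have h1 : K.cutoff e j x * ‖K.l j x‖ ≤ 2 * e * ‖x‖ := by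
        rw [norm_l_eq hx]
        calc _ ≤ 1 * (2 * e * ‖x‖) := by
              gcongr
              exact mul_nonneg relDist_nonneg (norm_nonneg _)
              exact cutoff_le_one
          _ = _ := one_mul _
      calc _ ≤ (2 * e * ‖x‖) * M := by
            gcongr
            exact norm_dualField_le he hx hM
        _ = _ := by ring
  refine (norm_sum_le_of_le _ this).trans (le_of_eq ?_)
  simp; ring

lemma exists_fourApart : ∃ e₀ : ℝ, 0 < e₀ ∧ ∀ e, e ≤ e₀ → K.FourApart e := by
  have h1 : ∀ f : {f : Fin 4 → Fin n // Function.Injective f}, ∃ δ : ℝ, 0 < δ ∧ ∀ x, x ≠ 0 →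
      ∃ k, δ ≤ K.relDist (f.1 k) x := by
    rintro ⟨f, hf⟩
    obtain ⟨C, hC, hanti⟩ := LinearMap.exists_antilipschitzWith _
      (LinearMap.ker_eq_bot.2 (K.injective_of_card_four hf))
    refine ⟨(C : ℝ)⁻¹, by positivity, fun x hx => ?_⟩
    have hle := hanti.le_mul_dist x 0
    rw [map_zero, dist_zero_right, dist_zero_right] at hle
    by_contra! h
    have hlt : ‖LinearMap.pi (K.l ∘ f) x‖ < (C : ℝ)⁻¹ * ‖x‖ := by
      rw [pi_norm_lt_iff (by positivity)]
      intro k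
      have := h k
      simp only [LinearMap.pi_apply, Function.comp]
      rw [norm_l_eq hx]
      gcongr
    have hC' : (0 : ℝ) < C := by exact_mod_cast hC
    have := mul_lt_mul_of_pos_left hlt hC'
    rw [← mul_assoc, mul_inv_cancel₀ hC'.ne', one_mul] at this
    linarith
  choose δ hδ h using h1
  obtain ⟨δ₀, hδ₀, hle⟩ : ∃ δ₀ : ℝ, 0 < δ₀ ∧ ∀ f, δ₀ ≤ δ f := by
    have : ∀ᶠ d in 𝓝[>] (0 : ℝ), ∀ f, d ≤ δ f := by
      rw [eventually_all]
      exact fun f => mem_nhdsWithin_of_mem_nhds (Iic_mem_nhds (hδ f))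
    obtain ⟨d, hd, hd0⟩ := (this.and self_mem_nhdsWithin).exists
    exact ⟨d, hd0, hd⟩
  refine ⟨δ₀ / 4, by positivity, fun e he f hf x hx => ?_⟩
  obtain ⟨k, hk⟩ := h ⟨f, hf⟩ x hx
  exact ⟨k, by have := hle ⟨f, hf⟩; linarith⟩

lemma relDist_c_pos {i : Fin n} (h : j ≠ i) : 0 < K.relDist j (K.c i) :=
  div_pos (norm_pos_iff.2 (K.l_c_ne j i h)) (norm_pos_iff.2 (K.c_ne i))

/-- The normalised proximity weights. -/
def proxWeight (K : CameraConfig n) (e : ℝ) (x : Fin 4 → ℂ) (i : Fin n) : ℝ :=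
  max 0 (e - K.relDist i x) / ∑ k, max 0 (e - K.relDist k x)

lemma relDist_eq_zero {i : Fin n} (h : K.l i x = 0) : K.relDist i x = 0 := by simp [relDist, h]

lemma sum_prox_pos (he : 0 < e) {i : Fin n} (h : K.l i x = 0) :
    0 < ∑ k, max 0 (e - K.relDist k x) :=
  Finset.sum_pos' (fun _ _ => le_max_left _ _)
    ⟨i, Finset.mem_univ _, lt_max_of_lt_right (by rw [relDist_eq_zero h]; linarith)⟩

lemma nonempty_snap (K : CameraConfig n) : Nonempty K.Snap := by
  classical
  have hdual : ∀ S : Finset (Fin n), ∀ j, ∃ v : Fin 4 → ℂ, S.card = 3 → ∀ k ∈ S,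
      K.l k v = if k = j then 1 else 0 := by
    intro S j
    by_cases hS : S.card = 3
    · obtain ⟨v, hv⟩ := K.exists_dual hS j
      exact ⟨v, fun _ => hv⟩
    · exact ⟨0, fun h => absurd h hS⟩
  choose v hv' using hdual
  have hv : ∀ S : Finset (Fin n), S.card = 3 → ∀ j, ∀ k ∈ S,
    K.l k (v S j) = if k = j then 1 else 0 := fun S hS j => hv' S j hS
  let M : ℝ := ∑ S, ∑ j, ‖v S j‖
  have hM : ∀ S j, ‖v S j‖ ≤ M := fun S j =>
    (Finset.single_le_sum (f := fun j => ‖v S j‖) (fun _ _ => norm_nonneg _)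
      (Finset.mem_univ j)).trans
    (Finset.single_le_sum (f := fun S => ∑ j, ‖v S j‖)
      (fun _ _ => Finset.sum_nonneg fun _ _ => norm_nonneg _) (Finset.mem_univ S))
  have hM0 : 0 ≤ M := Finset.sum_nonneg fun _ _ => Finset.sum_nonneg fun _ _ => norm_nonneg _
  obtain ⟨e₀, he₀, hfour⟩ := K.exists_fourApart
  have hev : ∀ᶠ e in 𝓝[>] (0 : ℝ), 0 < e ∧ e ≤ e₀ ∧ n * (2 * e * M) < 1 / 2 ∧
      ∀ i j, j ≠ i → 4 * e < K.relDist j (K.c i) := by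
    refine Filter.Eventually.and self_mem_nhdsWithin (Filter.Eventually.and
      (mem_nhdsWithin_of_mem_nhds (Iic_mem_nhds he₀)) (Filter.Eventually.and ?_ ?_))
    · refine mem_nhdsWithin_of_mem_nhds (ContinuousAt.eventually_lt ?_ continuousAt_const ?_)
      · fun_prop
      · norm_num
    · rw [eventually_all]; intro i
      rw [eventually_all]; intro j
      by_cases h : j = i
      · simp [h]
      · refine mem_nhdsWithin_of_mem_nhds ?_
        have : ∀ᶠ e : ℝ in 𝓝 0, 4 * e < K.relDist j (K.c i) :=
          ContinuousAt.eventually_lt (by fun_prop) continuousAt_const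
            (by simpa using relDist_c_pos h)
        filter_upwards [this] with e he _ using he
  obtain ⟨e, he, hee, hnM, hc⟩ := hev.exists
  have hF := hfour e hee
  have hsmall : ∀ x, x ≠ 0 → ∀ t ∈ Set.Icc (0 : ℝ) 1,
      ‖x‖ / 2 < ‖x - (t : ℂ) • K.snapField v e x‖ := by
    intro x hx t ht
    have hxp := norm_pos_iff.2 hx
    have h1 : ‖(t : ℂ) • K.snapField v e x‖ < ‖x‖ / 2 := by
      rw [norm_smul, Complex.norm_real, Real.norm_of_nonneg ht.1]
      calc t * ‖K.snapField v e x‖ ≤ 1 * ‖K.snapField v e x‖ := by gcongr; exact ht.2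
        _ ≤ (n * (2 * e * M)) * ‖x‖ := by
          rw [one_mul]; exact norm_snapField_le he hF hx hM0 hM
        _ < (1 / 2) * ‖x‖ := by gcongr
        _ = _ := by ring
    have := norm_sub_norm_le x ((t : ℂ) • K.snapField v e x)
    linarith
  have hl0 : ∀ i x, x ≠ 0 → K.l i x = 0 → K.l i (K.snapField v e x) = 0 := by
    intro i x hx hl
    rw [l_snapField hF hx hv (by rw [relDist_eq_zero hl]; linarith), hl, mul_zero]
  refine ⟨K.snapField v e, K.proxWeight e, fun x hx => continuousAt_snapField hF hx, ?_,
    fun μ x hμ => snapField_smul hμ, ?_, ?_, hl0, ?_, ?_, ?_, ?_⟩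
  · intro i x hx hl
    refine continuousAt_pi.2 fun j => ContinuousAt.div ?_ ?_ (sum_prox_pos he hl).ne'
    · exact Filter.Tendsto.max continuousAt_const
        (continuousAt_const.sub (continuousAt_relDist hx))
    · exact tendsto_finsetSum _ fun k _ => Filter.Tendsto.max continuousAt_const
        (continuousAt_const.sub (continuousAt_relDist hx))
  · intro μ x hμ
    funext i
    simp only [proxWeight, relDist_smul hμ]
  · intro x hx t ht h0
    have := hsmall x hx t ht
    rw [h0, norm_zero] at this
    have := norm_nonneg x
    linarith
  · intro i x hx hl hΔ t ht hA
    obtain ⟨a, ha⟩ := (K.mulVec_eq_zero i _).1 hA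
    have hbig := hsmall x hx t ht
    obtain ⟨j, -, hj⟩ := Finset.exists_ne_zero_of_sum_ne_zero hΔ
    have hcut : K.cutoff e j x ≠ 0 := fun h => hj (by simp [h])
    have hlj : K.l j x ≠ 0 := fun h => hj (by simp [h])
    have hji : j ≠ i := fun h => hlj (h ▸ hl)
    have hr : K.relDist j x ≤ 2 * e := by
      by_contra! h
      exact hcut (cutoff_eq_zero he h.le)
    have ha0 : a ≠ 0 := by
      rintro rfl
      rw [ha, zero_smul, norm_zero] at hbig
      have := norm_nonneg x
      linarith
    have hrc := hc i j hji
    rw [← relDist_smul (x := K.c i) ha0, ← ha] at hrc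
    have hne : x - (t : ℂ) • K.snapField v e x ≠ 0 := by
      rw [ha]; exact smul_ne_zero ha0 (K.c_ne i)
    have hlt : ‖K.l j (x - (t : ℂ) • K.snapField v e x)‖ ≤ 2 * e * ‖x‖ := by
      rw [map_sub, map_smul, l_snapField hF hx hv hr, smul_eq_mul, ← mul_assoc, ← one_sub_mul,
        norm_mul, norm_l_eq hx]
      have h1 : ‖(1 : ℂ) - (t : ℂ) * (K.cutoff e j x : ℂ)‖ ≤ 1 := by
        rw [← Complex.ofReal_mul, ← Complex.ofReal_one, ← Complex.ofReal_sub, Complex.norm_real,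
          Real.norm_eq_abs, abs_le]
        have := mul_nonneg ht.1 (cutoff_nonneg (K := K) (e := e) (j := j) (x := x))
        have := mul_le_one₀ ht.2 (cutoff_nonneg (K := K) (e := e) (j := j) (x := x)) cutoff_le_one
        constructor <;> linarith
      calc _ ≤ 1 * (2 * e * ‖x‖) := by
            gcongr
            exact mul_nonneg relDist_nonneg (norm_nonneg _)
        _ = _ := one_mul _
    rw [norm_l_eq hne] at hlt
    have h2 : 4 * e * (‖x‖ / 2) < K.relDist j (x - (t : ℂ) • K.snapField v e x) *
        ‖x - (t : ℂ) • K.snapField v e x‖ := by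
      have := norm_pos_iff.2 hx
      gcongr
    linarith
  · intro i s hs
    have hne : s • K.c i ≠ 0 := smul_ne_zero hs (K.c_ne i)
    have : ∀ᶠ x in 𝓝 (s • K.c i), ∀ j, j ≠ i → 2 * e < K.relDist j x := by
      rw [eventually_all]; intro j
      by_cases h : j = i
      · simp [h]
      · have : ∀ᶠ x in 𝓝 (s • K.c i), 2 * e < K.relDist j x :=
          ContinuousAt.eventually_lt continuousAt_const (continuousAt_relDist hne)
            (by rw [relDist_smul hs]; have := hc i j h; linarith)
        filter_upwards [this] with x hx _ using hx
    filter_upwards [this] with x hx hl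
    refine Finset.sum_eq_zero fun j _ => ?_
    by_cases h : j = i
    · simp [h, hl]
    · simp [cutoff_eq_zero he (hx j h).le]
  · intro i x hx hl
    have hpos := sum_prox_pos he hl
    refine ⟨fun k => div_nonneg (le_max_left _ _) hpos.le, ?_⟩
    simp only [proxWeight]
    rw [← Finset.sum_div, div_self hpos.ne']
  · intro i x hx hi
    have hr : K.relDist i x ≤ e := by
      by_contra! h
      exact hi (by rw [proxWeight, max_eq_left (by linarith), zero_div])
    rw [map_sub, l_snapField hF hx hv (by linarith), cutoff_eq_one he hr]
    simp

end CameraConfig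

/-! Parametrisation of the divisor at infinity, and the snapping homotopy on it. -/

namespace CameraConfig

variable {n : ℕ} {K : CameraConfig n} {i i' j : Fin n} {x x' w w' : Fin 4 → ℂ}

lemma continuousAt_pt {T : Type*} [TopologicalSpace T] {f g : T → Fin 4 → ℂ} {t : T}
    (hf : ContinuousAt f t) (hg : ContinuousAt g t) (h : K.Valid i (f t) (g t)) :
    ContinuousAt (fun t => K.pt i (f t) (g t)) t := by
  have key : ∀ (j : Fin n) (u : T → Fin 4 → ℂ), ContinuousAt u t → (K.A j).mulVec (u t) ≠ 0 →
      ContinuousAt (fun t => mkP ((K.A j).mulVec (u t))) t := by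
    intro j u hu hne
    refine ContinuousAt.comp (g := mkP) (f := fun t => (K.A j).mulVec (u t))
      (continuousAt_mkP hne) ?_
    exact ContinuousAt.comp (g := fun v => (K.A j).mulVec v)
      (Continuous.matrix_mulVec continuous_const continuous_id).continuousAt hu
  refine continuousAt_pi.2 fun j => ?_
  by_cases hj : j = i
  · subst hj
    simpa only [pt, if_true] using key j g hg h.Aw
  · simpa only [pt, hj, if_false] using key j f hf (h.A_ne hj)

lemma exists_plane_param (K : CameraConfig n) (i : Fin n) :
    ∃ B : (Fin 2 → ℂ) →ₗ[ℂ] (Fin 4 → ℂ), (∀ w, K.l i (B w) = 0) ∧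
      (∀ w, (K.A i).mulVec (B w) = 0 → w = 0) ∧
      ∀ x, K.l i x = 0 → ∃ (a : ℂ) (w : _), x = a • K.c i + B w := by
  obtain ⟨j, hj⟩ := K.exists_ne i
  obtain ⟨B, hB, h⟩ := K.exists_line_param hj.symm
  have hjc := K.l_c_ne j i hj
  have hw := fun w => (h (B w)).2 ⟨w, rfl⟩
  refine ⟨B, fun w => (hw w).1, fun w h0 => ?_, fun x hx => ?_⟩
  · have : B w = 0 := eq_zero_of_mulVec (i := j) (hw w).2 hj.symm h0
    exact hB (this.trans (map_zero B).symm)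
  · obtain ⟨w, hw⟩ := (h (x - (K.l j x / K.l j (K.c i)) • K.c i)).1 (by
      simp [hx, K.l_c, hjc])
    exact ⟨_, w, by rw [← hw]; abel⟩

/-- A basis of a line in the plane `l i = 0` avoiding the centre `c i`. -/
def planeParam (K : CameraConfig n) (i : Fin n) : (Fin 2 → ℂ) →ₗ[ℂ] (Fin 4 → ℂ) :=
  (K.exists_plane_param i).choose

lemma l_planeParam (w : Fin 2 → ℂ) : K.l i (K.planeParam i w) = 0 :=
  (K.exists_plane_param i).choose_spec.1 w

lemma A_planeParam {w : Fin 2 → ℂ} (hw : w ≠ 0) : (K.A i).mulVec (K.planeParam i w) ≠ 0 :=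
  fun h => hw ((K.exists_plane_param i).choose_spec.2.1 w h)

lemma exists_planeParam (hx : K.l i x = 0) :
    ∃ (a : ℂ) (w : _), x = a • K.c i + K.planeParam i w :=
  (K.exists_plane_param i).choose_spec.2.2 x hx

lemma continuous_planeParam : Continuous (K.planeParam i) :=
  LinearMap.continuous_of_finiteDimensional _

/-- The point of the plane `l i = 0` with coordinates `st` on the line through `c i` and
the point with coordinates `w`. -/
def planePt (K : CameraConfig n) (i : Fin n) (w st : Fin 2 → ℂ) : Fin 4 → ℂ :=
  st 0 • K.c i + st 1 • K.planeParam i w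

/-- The parametrisation of the blowup at `c i` of the plane `l i = 0`. -/
def theta (K : CameraConfig n) (i : Fin n) (w st : Fin 2 → ℂ) : Fin n → P2 :=
  K.pt i (K.planePt i w st) (K.planeParam i w)

lemma valid_theta {w st : Fin 2 → ℂ} (hw : w ≠ 0) (hst : st ≠ 0) :
    K.Valid i (K.planePt i w st) (K.planeParam i w) := by
  refine ⟨fun h => hst ?_, ?_, l_planeParam w, A_planeParam hw, _, _, rfl⟩
  · have h1 := congrArg (K.A i).mulVec h
    simp only [planePt, Matrix.mulVec_add, Matrix.mulVec_smul, A_c, smul_zero, zero_add,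
      Matrix.mulVec_zero, smul_eq_zero, A_planeParam hw, or_false] at h1
    simp only [planePt, h1, zero_smul, add_zero, smul_eq_zero, K.c_ne i, or_false] at h
    funext k
    fin_cases k
    · exact h
    · exact h1
  · simp [planePt, K.l_c, l_planeParam]

lemma continuous_planePt : Continuous fun q : (Fin 2 → ℂ) × (Fin 2 → ℂ) => K.planePt i q.1 q.2 := by
  have := (continuous_planeParam (K := K) (i := i)).comp
    (continuous_fst : Continuous (Prod.fst : (Fin 2 → ℂ) × (Fin 2 → ℂ) → _))
  unfold planePt
  fun_prop

lemma theta_eq_iff {w st w' st' : Fin 2 → ℂ} (hw : w ≠ 0) (hst : st ≠ 0) (hw' : w' ≠ 0)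
    (hst' : st' ≠ 0) : K.theta i w st = K.theta i w' st' ↔
      ∃ ν μ : ℂ, ν ≠ 0 ∧ μ ≠ 0 ∧ w' = ν • w ∧ st' 0 = μ * st 0 ∧ ν * st' 1 = μ * st 1 := by
  rw [theta, theta, pt_eq_pt (valid_theta hw hst) (valid_theta hw' hst')]
  have huniq : ∀ (a b : ℂ) (u u' : Fin 2 → ℂ),
      a • K.c i + K.planeParam i u = b • K.c i + K.planeParam i u' → a = b ∧ u = u' := by
    intro a b u u' h
    have h1 := congrArg (K.A i).mulVec h
    simp only [Matrix.mulVec_add, Matrix.mulVec_smul, A_c, smul_zero, zero_add] at h1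
    have h2 : u = u' := by
      by_contra hne
      refine A_planeParam (K := K) (i := i) (sub_ne_zero.2 hne) ?_
      rw [map_sub, Matrix.mulVec_sub, h1, sub_self]
    subst h2
    have h3 := add_right_cancel h
    exact ⟨smul_left_injective ℂ (K.c_ne i) h3, rfl⟩
  constructor
  · rintro ⟨⟨μ, hμ, h1⟩, ν, a, hν, h2⟩
    have h2' : (0 : ℂ) • K.c i + K.planeParam i w' = a • K.c i + K.planeParam i (ν • w) := by
      rw [zero_smul, zero_add, h2, map_smul, add_comm]
    obtain ⟨rfl, rfl⟩ := huniq _ _ _ _ h2'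
    have h1' : st' 0 • K.c i + K.planeParam i (st' 1 • ν • w) =
        (μ * st 0) • K.c i + K.planeParam i ((μ * st 1) • w) := by
      simpa only [planePt, map_smul, smul_add, smul_smul] using h1
    obtain ⟨e0, e1⟩ := huniq _ _ _ _ h1'
    refine ⟨ν, μ, hν, hμ, rfl, e0, ?_⟩
    rw [smul_smul] at e1
    rw [mul_comm]
    exact smul_left_injective ℂ hw e1
  · rintro ⟨ν, μ, hν, hμ, rfl, e0, e1⟩
    refine ⟨⟨μ, hμ, ?_⟩, ν, 0, hν, by simp⟩
    simp only [planePt, map_smul, smul_add, smul_smul, e0]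
    rw [mul_comm (st' 1), e1]

lemma exists_theta_eq (h : K.Valid i x w) : ∃ u st : Fin 2 → ℂ, ‖u‖ = 1 ∧ ‖st‖ = 1 ∧
    K.pt i x w = K.theta i u st := by
  obtain ⟨α, u, hu⟩ := exists_planeParam h.lw
  have hu0 : u ≠ 0 := by
    rintro rfl
    exact h.Aw (by simp [hu, Matrix.mulVec_smul])
  obtain ⟨a, b, hx⟩ := h.line
  have hx' : x = (a + b * α) • K.c i + b • K.planeParam i u := by
    rw [hx, hu, smul_add, smul_smul, add_smul, add_assoc]
  let p : Fin 2 → ℂ := ![a + b * α, b]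
  have hp : p ≠ 0 := by
    intro hp
    have h0 := congrFun hp 0
    have h1 := congrFun hp 1
    simp only [p, Matrix.cons_val_zero, Matrix.cons_val_one, Pi.zero_apply] at h0 h1
    exact h.ne (by rw [hx', h0, h1]; simp)
  have hpt : K.pt i x w = K.theta i u p := by
    rw [theta, pt_eq_pt h (valid_theta hu0 hp)]
    refine ⟨⟨1, one_ne_zero, by rw [one_smul, hx']; simp [planePt, p]⟩, 1, -α, one_ne_zero, ?_⟩
    rw [hu]; simp
  let st : Fin 2 → ℂ := ![a + b * α, ‖u‖ * b]
  have hn : (‖u‖ : ℂ) ≠ 0 := by simpa using hu0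
  have hst : st ≠ 0 := by
    intro hs
    have h0 := congrFun hs 0
    have h1 := congrFun hs 1
    simp only [st, Matrix.cons_val_zero, Matrix.cons_val_one, Pi.zero_apply, mul_eq_zero, hn,
      false_or] at h0 h1
    apply hp
    funext k
    fin_cases k
    · exact h0
    · exact h1
  have hm : (‖st‖ : ℂ) ≠ 0 := by simpa using hst
  have h1 : ‖(‖u‖ : ℂ)⁻¹ • u‖ = 1 := by simp [norm_smul, hu0]
  have h2 : ‖(‖st‖ : ℂ)⁻¹ • st‖ = 1 := by simp [norm_smul, hst]
  refine ⟨(‖u‖ : ℂ)⁻¹ • u, (‖st‖ : ℂ)⁻¹ • st, h1, h2, ?_⟩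
  rw [hpt, theta_eq_iff hu0 hp (smul_ne_zero (inv_ne_zero hn) hu0)
    (smul_ne_zero (inv_ne_zero hm) hst)]
  refine ⟨_, (‖st‖ : ℂ)⁻¹, inv_ne_zero hn, inv_ne_zero hm, rfl, ?_, ?_⟩
  · simp [st, p]
  · simp only [st, p, Pi.smul_apply, smul_eq_mul, Matrix.cons_val_one,
      Matrix.cons_val_fin_one]
    field_simp

end CameraConfig

/-! The snapping homotopy. -/

namespace CameraConfig

variable {n : ℕ} {K : CameraConfig n} {i i' j : Fin n} {x x' w w' : Fin 4 → ℂ}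

namespace Snap

variable (S : K.Snap)

/-- The second vector of the moved point. -/
def moveAux (x w : Fin 4 → ℂ) (t : ℝ) : Fin 4 → ℂ :=
  open Classical in if S.Δ x = 0 then w else x - (t : ℂ) • S.Δ x

/-- The displaced point. -/
def move (i : Fin n) (x w : Fin 4 → ℂ) (t : ℝ) : Fin n → P2 :=
  K.pt i (x - (t : ℂ) • S.Δ x) (S.moveAux x w t)

variable {S} {t : ℝ}

lemma l_sub (hx : x ≠ 0) (hl : K.l j x = 0) : K.l j (x - (t : ℂ) • S.Δ x) = 0 := by
  simp [hl, S.l_Δ j x hx hl]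

lemma valid_move (h : K.Valid i x w) (ht : t ∈ Set.Icc (0 : ℝ) 1) :
    K.Valid i (x - (t : ℂ) • S.Δ x) (S.moveAux x w t) := by
  unfold moveAux
  split_ifs with h0
  · simpa [h0] using h
  · exact valid_self (l_sub h.ne h.lx) (S.A_ne i x h.ne h.lx h0 t ht)

lemma move_congr (h : K.Valid i x w) (h' : K.Valid i' x' w') (e : K.pt i x w = K.pt i' x' w') :
    S.move i x w t = S.move i' x' w' t := by
  obtain ⟨μ, hμ, rfl⟩ := exists_smul_of_pt_eq h h' e
  have hΔ := S.Δ_smul μ x hμ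
  unfold move moveAux
  by_cases h0 : S.Δ x = 0
  · simp only [hΔ, h0, smul_zero, sub_zero, if_true]
    exact e
  · simp only [hΔ, h0, if_false, smul_eq_zero, hμ, or_self]
    rw [smul_comm, ← smul_sub, pt_self i i']
    funext j
    simp only [pt, ite_self]
    rw [Matrix.mulVec_smul, mkP_smul hμ]

lemma move_zero (h : K.Valid i x w) : S.move i x w 0 = K.pt i x w := by
  unfold move moveAux
  split_ifs with h0
  · simp
  · have := S.A_ne i x h.ne h.lx h0 0 (by simp)
    simp only [Complex.ofReal_zero, zero_smul, sub_zero] at this ⊢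
    exact (h.pt_eq_self this).symm

lemma move_eq_of_ne {τ s : ℂ} (h : K.Valid i x w) (ht : t ∈ Set.Icc (0 : ℝ) 1) (hτ : τ ≠ 0)
    (hx : x = s • K.c i + τ • w) :
    S.move i x w t = K.pt i (x - (t : ℂ) • S.Δ x) (w - (t * τ⁻¹ : ℂ) • S.Δ x) ∧
      K.Valid i (x - (t : ℂ) • S.Δ x) (w - (t * τ⁻¹ : ℂ) • S.Δ x) := by
  unfold move moveAux
  split_ifs with h0
  · simpa [h0] using h
  · have hA := S.A_ne i x h.ne h.lx h0 t ht
    have hu : x - (t : ℂ) • S.Δ x = s • K.c i + τ • (w - (t * τ⁻¹ : ℂ) • S.Δ x) := by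
      rw [smul_sub, smul_smul, show τ * (t * τ⁻¹) = t by field_simp, ← add_sub_assoc, ← hx]
    have hV : K.Valid i (x - (t : ℂ) • S.Δ x) (w - (t * τ⁻¹ : ℂ) • S.Δ x) := by
      refine ⟨S.sub_ne x h.ne t ht, l_sub h.ne h.lx, ?_, fun hz => hA ?_, s, τ, hu⟩
      · simp [h.lw, S.l_Δ i x h.ne h.lx]
      · rw [hu, Matrix.mulVec_add, Matrix.mulVec_smul, Matrix.mulVec_smul, hz]; simp
    exact ⟨(hV.pt_eq_self hA).symm, hV⟩

end Snap

/-- Compact parameter space for the divisor at infinity. -/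
abbrev Param (n : ℕ) : Type :=
  Fin n × (↥(Metric.sphere (0 : Fin 2 → ℂ) 1) × ↥(Metric.sphere (0 : Fin 2 → ℂ) 1))

lemma sphere_ne (u : ↥(Metric.sphere (0 : Fin 2 → ℂ) 1)) : u.1 ≠ 0 :=
  fun h => by simpa [h] using u.2

lemma valid_param (q : Param n) :
    K.Valid q.1 (K.planePt q.1 q.2.1.1 q.2.2.1) (K.planeParam q.1 q.2.1.1) :=
  valid_theta (sphere_ne _) (sphere_ne _)

lemma continuous_param_planePt (i : Fin n) :
    Continuous fun q : ↥(Metric.sphere (0 : Fin 2 → ℂ) 1) × ↥(Metric.sphere (0 : Fin 2 → ℂ) 1) =>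
      K.planePt i q.1.1 q.2.1 :=
  continuous_planePt.comp (Continuous.prodMap continuous_subtype_val continuous_subtype_val)

lemma continuous_param_planeParam (i : Fin n) :
    Continuous fun q : ↥(Metric.sphere (0 : Fin 2 → ℂ) 1) × ↥(Metric.sphere (0 : Fin 2 → ℂ) 1) =>
      K.planeParam i q.1.1 :=
  continuous_planeParam.comp (continuous_subtype_val.comp continuous_fst)

/-- The parametrisation of the divisor at infinity. -/
def toDinf (K : CameraConfig n) (q : Param n) : ↥(⋃ i, Dinf K.A K.Cs i) :=
  ⟨K.theta q.1 q.2.1.1 q.2.2.1,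
    Set.mem_iUnion.2 ⟨q.1, mem_Dinf_iff.2 ⟨_, _, valid_param q, rfl⟩⟩⟩

lemma continuous_toDinf : Continuous K.toDinf := by
  refine Continuous.subtype_mk (continuous_prod_of_discrete_left.2 fun i => ?_) _
  refine continuous_iff_continuousAt.2 fun q => ?_
  exact continuousAt_pt (continuous_param_planePt i).continuousAt
    (continuous_param_planeParam i).continuousAt (valid_param (i, q))

lemma surjective_toDinf : Function.Surjective K.toDinf := by
  rintro ⟨P, hP⟩
  obtain ⟨i, hi⟩ := Set.mem_iUnion.1 hP
  obtain ⟨x, w, h, rfl⟩ := mem_Dinf_iff.1 hi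
  obtain ⟨u, st, hu, hst, e⟩ := exists_theta_eq h
  exact ⟨(i, ⟨u, by simpa using hu⟩, ⟨st, by simpa using hst⟩), Subtype.ext e.symm⟩

lemma isQuotientMap_toDinf : Topology.IsQuotientMap K.toDinf :=
  continuous_toDinf.isClosedMap.isQuotientMap continuous_toDinf surjective_toDinf

lemma isQuotientMap_toDinf_prod :
    Topology.IsQuotientMap (Prod.map K.toDinf (id : unitInterval → unitInterval)) := by
  have hc : Continuous (Prod.map K.toDinf (id : unitInterval → unitInterval)) :=
    continuous_toDinf.prodMap continuous_id
  exact hc.isClosedMap.isQuotientMap hc (surjective_toDinf.prodMap Function.surjective_id)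

/-- The parametrised homotopy. -/
def Snap.moveParam (S : K.Snap) (q : Param n × unitInterval) : Fin n → P2 :=
  S.move q.1.1 (K.planePt q.1.1 q.1.2.1.1 q.1.2.2.1) (K.planeParam q.1.1 q.1.2.1.1) q.2

lemma Snap.continuous_moveParam (S : K.Snap) : Continuous S.moveParam := by
  have : Continuous fun q : Fin n × ((↥(Metric.sphere (0 : Fin 2 → ℂ) 1) ×
      ↥(Metric.sphere (0 : Fin 2 → ℂ) 1)) × unitInterval) => S.moveParam ((q.1, q.2.1), q.2.2) := by
    refine continuous_prod_of_discrete_left.2 fun i => continuous_iff_continuousAt.2 fun q => ?_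
    let X : (↥(Metric.sphere (0 : Fin 2 → ℂ) 1) × ↥(Metric.sphere (0 : Fin 2 → ℂ) 1)) ×
      unitInterval → Fin 4 → ℂ := fun q => K.planePt i q.1.1.1 q.1.2.1
    let W : (↥(Metric.sphere (0 : Fin 2 → ℂ) 1) × ↥(Metric.sphere (0 : Fin 2 → ℂ) 1)) ×
      unitInterval → Fin 4 → ℂ := fun q => K.planeParam i q.1.1.1
    let τ : (↥(Metric.sphere (0 : Fin 2 → ℂ) 1) × ↥(Metric.sphere (0 : Fin 2 → ℂ) 1)) ×
      unitInterval → ℂ := fun q => q.1.2.1 1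
    have hX : Continuous X := (continuous_param_planePt i).comp continuous_fst
    have hW : Continuous W := (continuous_param_planeParam i).comp continuous_fst
    have hτ : Continuous τ := (continuous_apply 1).comp
      (continuous_subtype_val.comp (continuous_snd.comp continuous_fst))
    have hV : ∀ q, K.Valid i (X q) (W q) := fun q => valid_param (i, q.1)
    have hΔ : Continuous fun q => S.Δ (X q) := continuous_iff_continuousAt.2 fun q =>
      ContinuousAt.comp (S.continuousAt_Δ _ (hV q).ne) hX.continuousAt
    have ht : Continuous fun q : (↥(Metric.sphere (0 : Fin 2 → ℂ) 1) ×
        ↥(Metric.sphere (0 : Fin 2 → ℂ) 1)) × unitInterval => ((q.2 : ℝ) : ℂ) :=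
      Complex.continuous_ofReal.comp (continuous_subtype_val.comp continuous_snd)
    by_cases h0 : τ q = 0
    · have hX0 : X q = q.1.2.1 0 • K.c i := by
        have : q.1.2.1 1 = 0 := h0
        simp [X, planePt, this]
      have hs : q.1.2.1 0 ≠ 0 := fun h => (hV q).ne (by rw [hX0, h, zero_smul])
      have hev : ∀ᶠ y in 𝓝 q, S.Δ (X y) = 0 := by
        have := S.eventually_zero i _ hs
        rw [← hX0] at this
        filter_upwards [hX.continuousAt.eventually this] with y hy using hy (hV y).lx
      refine (continuousAt_pt hX.continuousAt hW.continuousAt (hV q)).congr ?_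
      filter_upwards [hev] with y hy
      have hy' : S.Δ (K.planePt i y.1.1.1 y.1.2.1) = 0 := hy
      simp [Snap.moveParam, Snap.move, Snap.moveAux, hy', X, W]
    · have hev : ∀ᶠ y in 𝓝 q, τ y ≠ 0 := hτ.continuousAt.eventually_ne h0
      have key := fun y (hy : τ y ≠ 0) =>
        Snap.move_eq_of_ne (S := S) (hV y) y.2.2 hy (s := y.1.2.1 0) rfl
      refine (continuousAt_pt (f := fun y => X y - ((y.2 : ℝ) : ℂ) • S.Δ (X y))
        (g := fun y => W y - (((y.2 : ℝ) : ℂ) * (τ y)⁻¹) • S.Δ (X y)) ?_ ?_ (key q h0).2).congr ?_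
      · exact (hX.sub (ht.smul hΔ)).continuousAt
      · exact hW.continuousAt.sub ((ht.continuousAt.mul (hτ.continuousAt.inv₀ h0)).smul
          hΔ.continuousAt)
      · filter_upwards [hev] with y hy using (key y hy).1.symm
  exact this.comp (Homeomorph.prodAssoc _ _ _).continuous

lemma Snap.moveParam_mem (S : K.Snap) (q : Param n × unitInterval) :
    S.moveParam q ∈ ⋃ i, Dinf K.A K.Cs i :=
  Set.mem_iUnion.2 ⟨q.1.1, mem_Dinf_iff.2 ⟨_, _, Snap.valid_move (valid_param q.1) q.2.2, rfl⟩⟩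

theorem homotopyEquiv_divisor (K : CameraConfig n) :
    Nonempty (ContinuousMap.HomotopyEquiv ↥(⋃ i, Dinf K.A K.Cs i)
      ↥(blowupUnion (Dinf K.A K.Cs))) := by
  obtain ⟨S⟩ := K.nonempty_snap
  choose r hr using surjective_toDinf (K := K)
  have hrq : ∀ q, K.theta (r (K.toDinf q)).1 (r (K.toDinf q)).2.1.1 (r (K.toDinf q)).2.2.1 =
      K.theta q.1 q.2.1.1 q.2.2.1 := fun q => congrArg Subtype.val (hr (K.toDinf q))
  have hgc : Continuous fun p : ↥(⋃ i, Dinf K.A K.Cs i) × unitInterval =>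
      (⟨S.moveParam (r p.1, p.2), S.moveParam_mem _⟩ : ↥(⋃ i, Dinf K.A K.Cs i)) := by
    refine isQuotientMap_toDinf_prod.continuous_iff.2 ?_
    refine Continuous.subtype_mk (S.continuous_moveParam.congr fun q => ?_) _
    exact (Snap.move_congr (valid_param _) (valid_param _) (hrq q.1)).symm
  have hlc : Continuous fun p : ↥(⋃ i, Dinf K.A K.Cs i) =>
      S.lam (K.planePt (r p).1 (r p).2.1.1 (r p).2.2.1) := by
    refine isQuotientMap_toDinf.continuous_iff.2 ?_
    have : Continuous fun q : Param n => S.lam (K.planePt q.1 q.2.1.1 q.2.2.1) := by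
      refine continuous_prod_of_discrete_left.2 fun i => continuous_iff_continuousAt.2 fun q => ?_
      have hV := valid_param (K := K) (i, q)
      exact ContinuousAt.comp (f := fun q : ↥(Metric.sphere (0 : Fin 2 → ℂ) 1) ×
        ↥(Metric.sphere (0 : Fin 2 → ℂ) 1) => K.planePt i q.1.1 q.2.1)
        (S.continuousAt_lam i _ hV.ne hV.lx) (continuous_param_planePt i).continuousAt
    refine this.congr fun q => ?_
    obtain ⟨μ, hμ, h⟩ := exists_smul_of_pt_eq (valid_param _) (valid_param _) (hrq q)
    simp only [Function.comp]
    rw [h, S.lam_smul _ _ hμ]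
  have hmem : ∀ (p : ↥(⋃ i, Dinf K.A K.Cs i)) j, p.1 ∈ Dinf K.A K.Cs j ↔
      K.l j (K.planePt (r p).1 (r p).2.1.1 (r p).2.2.1) = 0 := fun p j => by
    rw [← (valid_param (r p)).pt_mem_Dinf, ← show (K.toDinf (r p)).1 = p.1 by rw [hr]]
    rfl
  refine homotopyEquiv_blowupUnion (Dinf K.A K.Cs) ⟨_, hgc⟩ ⟨_, hlc⟩ ?_ ?_ ?_ ?_
  · exact fun p => S.lam_mem _ _ (valid_param (r p)).ne (valid_param (r p)).lx
  · intro p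
    refine Subtype.ext ?_
    have := Snap.move_zero (S := S) (valid_param (r p))
    exact this.trans (congrArg Subtype.val (hr p))
  · intro p t j hj
    exact (Snap.valid_move (valid_param (r p)) t.2).pt_mem_Dinf.2
      (Snap.l_sub (valid_param (r p)).ne ((hmem p j).1 hj))
  · intro p j hj
    refine (Snap.valid_move (valid_param (r p)) (1 : unitInterval).2).pt_mem_Dinf.2 ?_
    have := S.snap j _ (valid_param (r p)).ne hj
    simpa using this

end CameraConfig

/-! Cell decompositions modelled on products of projective lines and intervals. -/

/-- The parametrisation of the upper hemisphere. -/
def hemi (z : ℂ) : Fin 2 → ℂ := ![(√(1 - ‖z‖ ^ 2) : ℝ), z]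

/-- The point at infinity of the line. -/
def infVec : Fin 2 → ℂ := ![0, 1]

lemma infVec_ne : infVec ≠ 0 := fun h => by simpa [infVec] using congrFun h 1

lemma hemi_ne (z : ℂ) : hemi z ≠ 0 := fun h => by
  have h0 := congrFun h 0
  have h1 : z = 0 := congrFun h 1
  simp [hemi, h1] at h0

lemma continuous_hemi : Continuous hemi := by
  refine continuous_pi fun k => ?_
  fin_cases k
  · exact Complex.continuous_ofReal.comp (by fun_prop)
  · exact continuous_id

lemma hemi_zero_of_norm {z : ℂ} (hz : ‖z‖ = 1) : hemi z 0 = 0 := by simp [hemi, hz]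

lemma sqrt_pos_of_mem_ball {z : ℂ} (hz : z ∈ Metric.ball (0 : ℂ) 1) : 0 < √(1 - ‖z‖ ^ 2) := by
  have : ‖z‖ < 1 := by simpa using hz
  have := norm_nonneg z
  exact Real.sqrt_pos.2 (by nlinarith)

lemma hemi_zero_ne {z : ℂ} (hz : z ∈ Metric.ball (0 : ℂ) 1) : hemi z 0 ≠ 0 := by
  have := (sqrt_pos_of_mem_ball hz).ne'
  simpa [hemi] using this

lemma hemi_unique {z z' ν : ℂ} (hz : z ∈ Metric.ball (0 : ℂ) 1) (hz' : z' ∈ Metric.ball (0 : ℂ) 1)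
    (h : hemi z' = ν • hemi z) : ν = 1 ∧ z = z' := by
  have hr := sqrt_pos_of_mem_ball hz
  have hr' := sqrt_pos_of_mem_ball hz'
  have h0 : ((√(1 - ‖z'‖ ^ 2) : ℝ) : ℂ) = ν * (√(1 - ‖z‖ ^ 2) : ℝ) := congrFun h 0
  have h1 : z' = ν * z := congrFun h 1
  have hb : ‖z‖ < 1 := by simpa using hz
  have hb' : ‖z'‖ < 1 := by simpa using hz'
  have n0 := congrArg (fun c => ‖c‖ ^ 2) h0
  simp only [norm_mul, Complex.norm_real, mul_pow, Real.norm_eq_abs, sq_abs] at n0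
  have p1 := norm_nonneg z
  have p2 := norm_nonneg z'
  rw [Real.sq_sqrt (by nlinarith), Real.sq_sqrt (by nlinarith)] at n0
  have n1 : ‖z'‖ ^ 2 = ‖ν‖ ^ 2 * ‖z‖ ^ 2 := by rw [h1, norm_mul, mul_pow]
  have n2 : ‖ν‖ ^ 2 = 1 := by nlinarith
  have hν : ν = ((√(1 - ‖z'‖ ^ 2) / √(1 - ‖z‖ ^ 2) : ℝ) : ℂ) := by
    rw [Complex.ofReal_div, h0]
    have : ((√(1 - ‖z‖ ^ 2) : ℝ) : ℂ) ≠ 0 := by exact_mod_cast hr.ne'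
    field_simp
  have hν1 : ν = 1 := by
    have hpos := div_pos hr' hr
    rw [hν, Complex.norm_real, Real.norm_of_nonneg hpos.le,
      pow_eq_one_iff_of_nonneg hpos.le two_ne_zero] at n2
    rw [hν, n2, Complex.ofReal_one]
  exact ⟨hν1, by rw [h1, hν1, one_mul]⟩

/-- Normal forms of homogeneous coordinates on the projective line. -/
lemma exists_normal_form {w : Fin 2 → ℂ} (hw : w ≠ 0) : ∃ ν : ℂ, ν ≠ 0 ∧
    ((w 0 = 0 ∧ ν • w = infVec) ∨
      (w 0 ≠ 0 ∧ ∃ z ∈ Metric.ball (0 : ℂ) 1, ν • w = hemi z)) := by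
  by_cases h0 : w 0 = 0
  · have h1 : w 1 ≠ 0 := fun h1 => hw (by ext k; fin_cases k <;> simp [h0, h1])
    refine ⟨(w 1)⁻¹, inv_ne_zero h1, Or.inl ⟨h0, ?_⟩⟩
    ext k; fin_cases k <;> simp [infVec, h0, h1]
  · let a : ℝ := ‖w 0‖
    have ha : 0 < a := norm_pos_iff.2 h0
    let R : ℝ := √(a ^ 2 + ‖w 1‖ ^ 2)
    have hR2 : R ^ 2 = a ^ 2 + ‖w 1‖ ^ 2 := Real.sq_sqrt (by positivity)
    have hR : 0 < R := Real.sqrt_pos.2 (by positivity)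
    have hac : (a : ℂ) ≠ 0 := by exact_mod_cast ha.ne'
    have hRc : (R : ℂ) ≠ 0 := by exact_mod_cast hR.ne'
    let ν : ℂ := a / (w 0 * R)
    have hνn : ‖ν‖ = R⁻¹ := by
      simp only [ν, norm_div, norm_mul, Complex.norm_real, Real.norm_of_nonneg ha.le,
        Real.norm_of_nonneg hR.le]
      change a / (a * R) = _
      field_simp
    have hn : ‖ν * w 1‖ ^ 2 = ‖w 1‖ ^ 2 / R ^ 2 := by
      rw [norm_mul, hνn, mul_pow, inv_pow]; field_simp
    have hsq : 1 - ‖ν * w 1‖ ^ 2 = (a / R) ^ 2 := by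
      rw [hn, div_pow, eq_div_iff (by positivity), sub_mul, div_mul_cancel₀ _ (by positivity), hR2]
      ring
    refine ⟨ν, div_ne_zero hac (mul_ne_zero h0 hRc), Or.inr ⟨h0, ν * w 1, ?_, ?_⟩⟩
    · rw [mem_ball_zero_iff]
      have : 0 < (a / R) ^ 2 := by positivity
      have := norm_nonneg (ν * w 1)
      nlinarith
    · ext k
      fin_cases k
      · simp only [hemi, hsq, Real.sqrt_sq (div_pos ha hR).le]
        simp only [ν, Fin.zero_eta, Pi.smul_apply, smul_eq_mul, Matrix.cons_val_zero,
          Complex.ofReal_div]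
        field_simp
      · simp [hemi]

variable {Z : Type} [TopologicalSpace Z] [T2Space Z]

lemma norm_eq_one_of_boundary {z : ℂ} (h : z ∈ Metric.closedBall (0 : ℂ) 1)
    (h' : z ∉ Metric.ball (0 : ℂ) 1) : ‖z‖ = 1 := by
  simp only [mem_closedBall_zero_iff, mem_ball_zero_iff, not_lt] at h h'
  exact le_antisymm h h'

lemma interior_unitDisc : interior (Metric.closedBall (0 : ℂ) 1) = Metric.ball 0 1 :=
  interior_closedBall _ one_ne_zero

lemma CellBuilt.attach_disc {K : Set Z} {c : ℤ} (hK : CellBuilt K c) (Φ : ℂ → Z)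
    (hΦ : Continuous Φ) (hbd : ∀ z, ‖z‖ = 1 → Φ z ∈ K)
    (hinj : Set.InjOn Φ (Metric.ball 0 1)) (hdisj : ∀ z ∈ Metric.ball (0 : ℂ) 1, Φ z ∉ K) :
    CellBuilt (K ∪ Φ '' Metric.ball 0 1) (c + 1) := by
  have := hK.attach (C := Metric.closedBall (0 : ℂ) 1) (convex_closedBall 0 1)
    (isCompact_closedBall 0 1) (by rw [interior_unitDisc]; exact ⟨0, by simp⟩) Φ hΦ.continuousOn
    (fun z hz hz' => hbd z (norm_eq_one_of_boundary hz (by rwa [interior_unitDisc] at hz')))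
    (by rwa [interior_unitDisc]) (by rwa [interior_unitDisc])
  rwa [interior_unitDisc, Complex.finrank_real_complex, show ((-1 : ℤ)) ^ 2 = 1 by norm_num] at this

lemma CellBuilt.attach_point {K : Set Z} {c : ℤ} (hK : CellBuilt K c) (p : Z) (hp : p ∉ K) :
    CellBuilt (K ∪ {p}) (c + 1) := by
  have := hK.attach (C := (Set.univ : Set (EuclideanSpace ℝ (Fin 0)))) convex_univ
    isCompact_univ (by rw [interior_univ]; exact Set.univ_nonempty) (fun _ => p) continuousOn_const
    (fun z _ hz' => absurd (by simp) hz') (fun _ _ _ _ _ => Subsingleton.elim _ _)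
    (fun _ _ => hp)
  simpa using this

/-- Attaching a ruled surface over a projective line. -/
lemma CellBuilt.attach_ruled {K : Set Z} {c : ℤ} (hK : CellBuilt K c)
    (F : (Fin 2 → ℂ) → (Fin 2 → ℂ) → Z)
    (hF : ContinuousOn (fun p : (Fin 2 → ℂ) × (Fin 2 → ℂ) => F p.1 p.2) {p | p.1 ≠ 0 ∧ p.2 ≠ 0})
    (hdisj : ∀ w st, w ≠ 0 → st ≠ 0 → F w st ∉ K)
    (heq : ∀ w st w' st', w ≠ 0 → st ≠ 0 → w' ≠ 0 → st' ≠ 0 → (F w st = F w' st' ↔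
      ∃ ν μ : ℂ, ν ≠ 0 ∧ μ ≠ 0 ∧ w' = ν • w ∧ st' 0 = μ * st 0 ∧ ν * st' 1 = μ * st 1)) :
    CellBuilt (K ∪ {p | ∃ w st, w ≠ 0 ∧ st ≠ 0 ∧ p = F w st}) (c + 4) := by
  have hcont : ∀ {T : Type} [TopologicalSpace T] (f g : T → Fin 2 → ℂ), Continuous f →
      Continuous g → (∀ t, f t ≠ 0) → (∀ t, g t ≠ 0) → Continuous fun t => F (f t) (g t) := by
    intro T _ f g hf hg hf0 hg0
    exact hF.comp_continuous (hf.prodMk hg) fun t => ⟨hf0 t, hg0 t⟩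
  have hnf : ∀ w st, w ≠ 0 → st ≠ 0 → ∃ w' st', F w st = F w' st' ∧
      ((w 0 = 0 ∧ w' = infVec) ∨ (w 0 ≠ 0 ∧ ∃ z ∈ Metric.ball (0 : ℂ) 1, w' = hemi z)) ∧
      ((st 0 = 0 ∧ st' = infVec) ∨
        (st 0 ≠ 0 ∧ ∃ z ∈ Metric.ball (0 : ℂ) 1, st' = hemi z)) := by
    intro w st hw hst
    obtain ⟨ν, hν, h⟩ := exists_normal_form hw
    let st₁ : Fin 2 → ℂ := ![st 0, ν⁻¹ * st 1]
    have hst₁ : st₁ ≠ 0 := by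
      intro h0
      have e0 : st 0 = 0 := congrFun h0 0
      have e1 : ν⁻¹ * st 1 = 0 := congrFun h0 1
      rw [mul_eq_zero, inv_eq_zero, or_iff_right hν] at e1
      exact hst (by ext k; fin_cases k <;> simp [e0, e1])
    obtain ⟨μ, hμ, h'⟩ := exists_normal_form hst₁
    refine ⟨ν • w, μ • st₁, ?_, h, h'⟩
    rw [heq _ _ _ _ hw hst (smul_ne_zero hν hw) (smul_ne_zero hμ hst₁)]
    refine ⟨ν, μ, hν, hμ, rfl, rfl, ?_⟩
    simp [st₁]
    field_simp
  have hzero : ∀ w st w' st', w ≠ 0 → st ≠ 0 → w' ≠ 0 → st' ≠ 0 → F w st = F w' st' →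
      (w' 0 = 0 ↔ w 0 = 0) ∧ (st' 0 = 0 ↔ st 0 = 0) := by
    intro w st w' st' hw hst hw' hst' h
    obtain ⟨ν, μ, hν, hμ, rfl, h0, -⟩ := (heq _ _ _ _ hw hst hw' hst').1 h
    simp [h0, hν, hμ]
  have hi0 : infVec 0 = 0 := rfl
  have hi := infVec_ne
  have h₁ := hK.attach_point (F infVec infVec) (hdisj _ _ hi hi)
  have mem₁ : ∀ w st, w ≠ 0 → st ≠ 0 → w 0 = 0 → st 0 = 0 →
      F w st ∈ K ∪ {F infVec infVec} := by
    intro w st hw hst hw0 hst0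
    obtain ⟨w', st', e, ⟨-, rfl⟩ | ⟨h, -⟩, ⟨-, rfl⟩ | ⟨h', -⟩⟩ := hnf w st hw hst
    · exact Or.inr e
    · exact absurd hst0 h'
    · exact absurd hw0 h
    · exact absurd hw0 h
  have h₂ := h₁.attach_disc (fun u => F infVec (hemi u))
    (hcont _ _ continuous_const continuous_hemi (fun _ => hi) hemi_ne)
    (fun z hz => mem₁ _ _ hi (hemi_ne z) hi0 (hemi_zero_of_norm hz)) (by
      intro u hu u' hu' h
      obtain ⟨ν, μ, -, -, h1, h2, h3⟩ := (heq _ _ _ _ hi (hemi_ne u) hi (hemi_ne u')).1 h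
      have hν : ν = 1 := by simpa [infVec] using (congrFun h1 1).symm
      refine (hemi_unique hu hu' (ν := μ) ?_).2
      ext k
      fin_cases k
      · exact h2
      · simpa [hν] using h3) (by
      rintro u hu (h | h)
      · exact hdisj _ _ hi (hemi_ne u) h
      · exact hemi_zero_ne hu ((hzero _ _ _ _ hi hi hi (hemi_ne u) h.symm).2.2 hi0))
  have h₃ := h₂.attach_disc (fun z => F (hemi z) infVec)
    (hcont _ _ continuous_hemi continuous_const hemi_ne fun _ => hi)
    (fun z hz => Or.inl (mem₁ _ _ (hemi_ne z) hi (hemi_zero_of_norm hz) hi0)) (by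
      intro u hu u' hu' h
      obtain ⟨ν, μ, -, -, h1, h2, h3⟩ := (heq _ _ _ _ (hemi_ne u) hi (hemi_ne u') hi).1 h
      exact (hemi_unique hu hu' h1).2) (by
      rintro u hu ((h | h) | ⟨u', -, h⟩)
      · exact hdisj _ _ (hemi_ne u) hi h
      · exact hemi_zero_ne hu ((hzero _ _ _ _ hi hi (hemi_ne u) hi h.symm).1.2 hi0)
      · exact hemi_zero_ne hu ((hzero _ _ _ _ hi (hemi_ne u') (hemi_ne u) hi h).1.2 hi0))
  have mem₃ : ∀ w st, w ≠ 0 → st ≠ 0 → w 0 = 0 ∨ st 0 = 0 → F w st ∈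
      K ∪ {F infVec infVec} ∪ (fun u => F infVec (hemi u)) '' Metric.ball 0 1 ∪
        (fun z => F (hemi z) infVec) '' Metric.ball 0 1 := by
    intro w st hw hst h0
    obtain ⟨w', st', e, ⟨-, rfl⟩ | ⟨h, z, hz, rfl⟩, ⟨-, rfl⟩ | ⟨h', u, hu, rfl⟩⟩ := hnf w st hw hst
    · exact Or.inl (Or.inl (Or.inr e))
    · exact Or.inl (Or.inr ⟨u, hu, e.symm⟩)
    · exact Or.inr ⟨z, hz, e.symm⟩
    · exact absurd h0 (by simp [h, h'])
  have hint : interior (Metric.closedBall (0 : ℂ) 1 ×ˢ Metric.closedBall (0 : ℂ) 1) =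
      Metric.ball (0 : ℂ) 1 ×ˢ Metric.ball (0 : ℂ) 1 := by
    rw [interior_prod_eq, interior_unitDisc]
  have h₄ := h₃.attach (C := Metric.closedBall (0 : ℂ) 1 ×ˢ Metric.closedBall (0 : ℂ) 1)
    ((convex_closedBall 0 1).prod (convex_closedBall 0 1))
    ((isCompact_closedBall 0 1).prod (isCompact_closedBall 0 1))
    (by rw [hint]; exact ⟨(0, 0), by simp⟩) (fun p => F (hemi p.1) (hemi p.2))
    (hcont _ _ (continuous_hemi.comp continuous_fst) (continuous_hemi.comp continuous_snd)
      (fun _ => hemi_ne _) fun _ => hemi_ne _).continuousOn (by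
      rintro ⟨z, u⟩ ⟨hz, hu⟩ h
      rw [hint] at h
      refine mem₃ _ _ (hemi_ne z) (hemi_ne u) ?_
      by_cases hz' : z ∈ Metric.ball (0 : ℂ) 1
      · have hu' : u ∉ Metric.ball (0 : ℂ) 1 := fun hu' => h ⟨hz', hu'⟩
        exact Or.inr (hemi_zero_of_norm (norm_eq_one_of_boundary hu hu'))
      · exact Or.inl (hemi_zero_of_norm (norm_eq_one_of_boundary hz hz'))) (by
      rw [hint]
      rintro ⟨z, u⟩ ⟨hz, hu⟩ ⟨z', u'⟩ ⟨hz', hu'⟩ h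
      obtain ⟨ν, μ, -, -, h1, h2, h3⟩ := (heq _ _ _ _ (hemi_ne z) (hemi_ne u) (hemi_ne z')
        (hemi_ne u')).1 h
      obtain ⟨rfl, rfl⟩ := hemi_unique hz hz' h1
      obtain ⟨-, rfl⟩ := hemi_unique hu hu' (ν := μ) (by
        ext k
        fin_cases k
        · exact h2
        · simpa using h3)
      rfl) (by
      rw [hint]
      rintro ⟨z, u⟩ ⟨hz, hu⟩ (((h | h) | ⟨u', -, h⟩) | ⟨z', -, h⟩)
      · exact hdisj _ _ (hemi_ne z) (hemi_ne u) h
      · exact hemi_zero_ne hz ((hzero _ _ _ _ hi hi (hemi_ne z) (hemi_ne u) h.symm).1.2 hi0)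
      · exact hemi_zero_ne hz ((hzero _ _ _ _ hi (hemi_ne u') (hemi_ne z) (hemi_ne u) h).1.2 hi0)
      · exact hemi_zero_ne hu ((hzero _ _ _ _ (hemi_ne z') hi (hemi_ne z) (hemi_ne u) h).2.2 hi0))
  rw [hint, Module.finrank_prod, Complex.finrank_real_complex] at h₄
  convert h₄ using 1
  · ext p
    constructor
    · rintro (h | ⟨w, st, hw, hst, rfl⟩)
      · exact Or.inl (Or.inl (Or.inl (Or.inl h)))
      · by_cases h0 : w 0 = 0 ∨ st 0 = 0
        · exact Or.inl (mem₃ w st hw hst h0)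
        · push Not at h0
          obtain ⟨w', st', e, ⟨h, -⟩ | ⟨-, z, hz, rfl⟩, ⟨h, -⟩ | ⟨-, u, hu, rfl⟩⟩ :=
            hnf w st hw hst
          · exact absurd h h0.2
          · exact absurd h h0.1
          · exact absurd h h0.2
          · exact Or.inr ⟨(z, u), ⟨hz, hu⟩, e.symm⟩
    · rintro ((((h | h) | ⟨u, -, rfl⟩) | ⟨z, -, rfl⟩) | ⟨p, -, rfl⟩)
      · exact Or.inl h
      · exact Or.inr ⟨_, _, hi, hi, h⟩
      · exact Or.inr ⟨_, _, hi, hemi_ne u, rfl⟩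
      · exact Or.inr ⟨_, _, hemi_ne z, hi, rfl⟩
      · exact Or.inr ⟨_, _, hemi_ne _, hemi_ne _, rfl⟩
  · norm_num; ring

/-- Attaching a projective line times an open interval. -/
lemma CellBuilt.attach_line_prod {K : Set Z} {c : ℤ} (hK : CellBuilt K c)
    (F : (Fin 2 → ℂ) → ℝ → Z)
    (hF : ContinuousOn (fun p : (Fin 2 → ℂ) × ℝ => F p.1 p.2) {p | p.1 ≠ 0})
    (hbd : ∀ w, w ≠ 0 → F w 0 ∈ K ∧ F w 1 ∈ K)
    (hdisj : ∀ w, w ≠ 0 → ∀ t ∈ Set.Ioo (0 : ℝ) 1, F w t ∉ K)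
    (heq : ∀ w w' t t', w ≠ 0 → w' ≠ 0 → (F w t = F w' t' ↔
      (∃ ν : ℂ, ν ≠ 0 ∧ w' = ν • w) ∧ t = t')) :
    CellBuilt (K ∪ {p | ∃ w, w ≠ 0 ∧ ∃ t ∈ Set.Ioo (0 : ℝ) 1, p = F w t}) (c + -2) := by
  have hnf : ∀ w t, w ≠ 0 → ∃ w', F w t = F w' t ∧
      ((w 0 = 0 ∧ w' = infVec) ∨ (w 0 ≠ 0 ∧ ∃ z ∈ Metric.ball (0 : ℂ) 1, w' = hemi z)) := by
    intro w t hw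
    obtain ⟨ν, hν, h⟩ := exists_normal_form hw
    exact ⟨ν • w, (heq _ _ _ _ hw (smul_ne_zero hν hw)).2 ⟨⟨ν, hν, rfl⟩, rfl⟩, h⟩
  have hi0 : infVec 0 = 0 := rfl
  have hi := infVec_ne
  have hend : ∀ {t : ℝ}, t ∈ Set.Icc (0 : ℝ) 1 → t ∉ Set.Ioo (0 : ℝ) 1 → t = 0 ∨ t = 1 := by
    intro t ht ht'
    by_contra! h
    exact ht' ⟨lt_of_le_of_ne ht.1 h.1.symm, lt_of_le_of_ne ht.2 h.2⟩
  have hmemK : ∀ {w t}, w ≠ 0 → t ∈ Set.Icc (0 : ℝ) 1 → t ∉ Set.Ioo (0 : ℝ) 1 → F w t ∈ K := by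
    intro w t hw ht ht'
    rcases hend ht ht' with rfl | rfl
    · exact (hbd w hw).1
    · exact (hbd w hw).2
  have h₁ := hK.attach (C := Set.Icc (0 : ℝ) 1) (convex_Icc 0 1) isCompact_Icc
    (by rw [interior_Icc]; exact ⟨1 / 2, by norm_num, by norm_num⟩) (fun t => F infVec t)
    (hF.comp_continuous (f := fun t : ℝ => (infVec, t)) (by fun_prop) fun _ => hi).continuousOn
    (fun t ht ht' => hmemK hi ht (by rwa [interior_Icc] at ht'))
    (fun t _ t' _ h => ((heq _ _ _ _ hi hi).1 h).2)
    (fun t ht => hdisj _ hi t (by rwa [interior_Icc] at ht))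
  rw [interior_Icc] at h₁
  have mem₁ : ∀ w t, w ≠ 0 → w 0 = 0 → t ∈ Set.Icc (0 : ℝ) 1 →
      F w t ∈ K ∪ (fun t => F infVec t) '' Set.Ioo 0 1 := by
    intro w t hw h0 ht
    by_cases ht' : t ∈ Set.Ioo (0 : ℝ) 1
    · obtain ⟨w', e, ⟨-, rfl⟩ | ⟨h, -⟩⟩ := hnf w t hw
      · exact Or.inr ⟨t, ht', e.symm⟩
      · exact absurd h0 h
    · exact Or.inl (hmemK hw ht ht')
  have hint : interior (Metric.closedBall (0 : ℂ) 1 ×ˢ Set.Icc (0 : ℝ) 1) =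
      Metric.ball (0 : ℂ) 1 ×ˢ Set.Ioo (0 : ℝ) 1 := by
    rw [interior_prod_eq, interior_unitDisc, interior_Icc]
  have h₂ := h₁.attach (C := Metric.closedBall (0 : ℂ) 1 ×ˢ Set.Icc (0 : ℝ) 1)
    ((convex_closedBall 0 1).prod (convex_Icc 0 1))
    ((isCompact_closedBall 0 1).prod isCompact_Icc)
    (by rw [hint]; exact ⟨(0, 1 / 2), by norm_num⟩) (fun p => F (hemi p.1) p.2)
    (hF.comp_continuous ((continuous_hemi.comp continuous_fst).prodMk continuous_snd)
      fun _ => hemi_ne _).continuousOn (by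
      rintro ⟨z, t⟩ ⟨hz, ht⟩ h
      rw [hint] at h
      by_cases hz' : z ∈ Metric.ball (0 : ℂ) 1
      · exact Or.inl (hmemK (hemi_ne z) ht fun ht' => h ⟨hz', ht'⟩)
      · exact mem₁ _ _ (hemi_ne z) (hemi_zero_of_norm (norm_eq_one_of_boundary hz hz')) ht) (by
      rw [hint]
      rintro ⟨z, t⟩ ⟨hz, -⟩ ⟨z', t'⟩ ⟨hz', -⟩ h
      obtain ⟨⟨ν, -, h1⟩, rfl⟩ := (heq _ _ _ _ (hemi_ne z) (hemi_ne z')).1 h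
      obtain ⟨-, rfl⟩ := hemi_unique hz hz' h1
      rfl) (by
      rw [hint]
      rintro ⟨z, t⟩ ⟨hz, ht⟩ (h | ⟨t', -, h⟩)
      · exact hdisj _ (hemi_ne z) t ht h
      · obtain ⟨⟨ν, -, h1⟩, -⟩ := (heq _ _ _ _ hi (hemi_ne z)).1 h
        exact hemi_zero_ne hz (by rw [h1]; simp [hi0]))
  rw [hint, Module.finrank_prod, Complex.finrank_real_complex, Module.finrank_self] at h₂
  convert h₂ using 1
  · ext p
    constructor
    · rintro (h | ⟨w, hw, t, ht, rfl⟩)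
      · exact Or.inl (Or.inl h)
      · obtain ⟨w', e, ⟨-, rfl⟩ | ⟨-, z, hz, rfl⟩⟩ := hnf w t hw
        · exact Or.inl (Or.inr ⟨t, ht, e.symm⟩)
        · exact Or.inr ⟨(z, t), ⟨hz, ht⟩, e.symm⟩
    · rintro ((h | ⟨t, ht, rfl⟩) | ⟨p, hp, rfl⟩)
      · exact Or.inl h
      · exact Or.inr ⟨_, hi, t, ht, rfl⟩
      · exact Or.inr ⟨_, hemi_ne _, p.2, hp.2, rfl⟩
  · norm_num; ring

/-- Attaching an open square. -/
lemma CellBuilt.attach_square {K : Set Z} {c : ℤ} (hK : CellBuilt K c) (F : ℝ × ℝ → Z)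
    (hF : Continuous F) (hbd : ∀ p ∈ Set.Icc (0 : ℝ) 1 ×ˢ Set.Icc (0 : ℝ) 1,
      p ∉ Set.Ioo (0 : ℝ) 1 ×ˢ Set.Ioo (0 : ℝ) 1 → F p ∈ K)
    (hinj : Set.InjOn F (Set.Ioo (0 : ℝ) 1 ×ˢ Set.Ioo (0 : ℝ) 1))
    (hdisj : ∀ p ∈ Set.Ioo (0 : ℝ) 1 ×ˢ Set.Ioo (0 : ℝ) 1, F p ∉ K) :
    CellBuilt (K ∪ F '' (Set.Ioo (0 : ℝ) 1 ×ˢ Set.Ioo (0 : ℝ) 1)) (c + 1) := by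
  have hint : interior (Set.Icc (0 : ℝ) 1 ×ˢ Set.Icc (0 : ℝ) 1) =
      Set.Ioo (0 : ℝ) 1 ×ˢ Set.Ioo (0 : ℝ) 1 := by
    rw [interior_prod_eq, interior_Icc]
  have := hK.attach (C := Set.Icc (0 : ℝ) 1 ×ˢ Set.Icc (0 : ℝ) 1)
    ((convex_Icc 0 1).prod (convex_Icc 0 1)) (isCompact_Icc.prod isCompact_Icc)
    (by rw [hint]; exact ⟨(1 / 2, 1 / 2), by norm_num⟩) F hF.continuousOn
    (by rwa [hint]) (by rwa [hint]) (by rwa [hint])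
  rw [hint, Module.finrank_prod, Module.finrank_self] at this
  simpa using this

/-! The Euler characteristic of the divisor at infinity of a camera configuration. -/

section Strata

variable {Z : Type} {n : ℕ} {H : Fin n → Set Z} {S : Finset (Fin n)}
  {𝒮 : Finset (Finset (Fin n))}

lemma strata_insert : strata H (insert S 𝒮) = strata H 𝒮 ∪
    {p | p.2 ∈ stdSimplex ℝ (Fin n) ∧ wsupp p.2 = S ∧ ∀ i ∈ S, p.1 ∈ H i} := by
  ext p
  simp only [strata, blowupUnion, Finset.mem_insert, Set.mem_ofPred_eq, Set.mem_union]
  constructor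
  · rintro ⟨⟨h, h'⟩, rfl | h𝒮⟩
    · exact Or.inr ⟨h, rfl, fun i hi => h' i (mem_wsupp.1 hi)⟩
    · exact Or.inl ⟨⟨h, h'⟩, h𝒮⟩
  · rintro (⟨h, h𝒮⟩ | ⟨h, rfl, h'⟩)
    · exact ⟨h, Or.inr h𝒮⟩
    · exact ⟨⟨h, fun i hi => h' i (mem_wsupp.2 hi)⟩, Or.inl rfl⟩

lemma mem_strata_of_ssubset (h𝒮 : ∀ T ⊂ S, T.Nonempty → T ∈ 𝒮) {P : Z} {u : Fin n → ℝ}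
    (hP : ∀ i ∈ S, P ∈ H i) (hu : u ∈ stdSimplex ℝ (Fin n)) (hS : wsupp u ⊂ S) :
    (P, u) ∈ strata H 𝒮 :=
  ⟨⟨hu, fun i hi => hP i (hS.1 (mem_wsupp.2 hi))⟩, h𝒮 _ hS (wsupp_nonempty hu)⟩

lemma notMem_strata (hS : S ∉ 𝒮) {P : Z} {u : Fin n → ℝ} (hu : wsupp u = S) :
    (P, u) ∉ strata H 𝒮 := fun h => hS (hu ▸ h.2)

end Strata

lemma apply_eq_zero_of_wsupp_eq {n : ℕ} {u : Fin n → ℝ} {S : Finset (Fin n)} (h : wsupp u = S)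
    {i : Fin n} (hi : i ∉ S) : u i = 0 := by
  by_contra h0
  exact hi (h ▸ mem_wsupp.2 h0)

lemma pos_of_wsupp_eq {n : ℕ} {u : Fin n → ℝ} {S : Finset (Fin n)} (h : wsupp u = S)
    (hu : u ∈ stdSimplex ℝ (Fin n)) {i : Fin n} (hi : i ∈ S) : 0 < u i :=
  (hu.1 i).lt_of_ne' (mem_wsupp.1 (h ▸ hi))

lemma sum_eq_one_of_wsupp_eq {n : ℕ} {u : Fin n → ℝ} {S : Finset (Fin n)} (h : wsupp u = S)
    (hu : u ∈ stdSimplex ℝ (Fin n)) : ∑ i ∈ S, u i = 1 := by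
  rw [← hu.2]
  exact Finset.sum_subset (Finset.subset_univ _) fun i _ hi => apply_eq_zero_of_wsupp_eq h hi

/-- Weights on the edge between two vertices of the simplex. -/
def edgeWeights {n : ℕ} (i j : Fin n) (t : ℝ) : Fin n → ℝ :=
  Pi.single i (1 - t) + Pi.single j t

/-- Weights on the triangle with three given vertices. -/
def triangleWeights {n : ℕ} (i j k : Fin n) (p : ℝ × ℝ) : Fin n → ℝ :=
  Pi.single i (1 - p.1) + Pi.single j (p.1 * (1 - p.2)) + Pi.single k (p.1 * p.2)

lemma single_apply_nonneg {n : ℕ} (i m : Fin n) {a : ℝ} (ha : 0 ≤ a) :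
    0 ≤ (Pi.single i a : Fin n → ℝ) m := by
  rw [Pi.single_apply]
  split_ifs
  exacts [ha, le_rfl]

section Weights

variable {n : ℕ} {i j k : Fin n}

lemma wsupp_single (i : Fin n) : wsupp (Pi.single i 1 : Fin n → ℝ) = {i} := by
  ext m
  by_cases h : m = i <;> simp [h]

lemma eq_single_of_wsupp_eq {u : Fin n → ℝ} (hu : u ∈ stdSimplex ℝ (Fin n))
    (h : wsupp u = {i}) : u = Pi.single i 1 := by
  have hs := sum_eq_one_of_wsupp_eq h hu
  funext m
  by_cases hm : m = i
  · subst hm; simpa using hs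
  · rw [Pi.single_eq_of_ne hm, apply_eq_zero_of_wsupp_eq h (by simpa using hm)]

lemma edgeWeights_mem {t : ℝ} (ht : t ∈ Set.Icc (0 : ℝ) 1) :
    edgeWeights i j t ∈ stdSimplex ℝ (Fin n) := by
  refine ⟨fun m => ?_, ?_⟩
  · exact add_nonneg (single_apply_nonneg _ _ (sub_nonneg.2 ht.2)) (single_apply_nonneg _ _ ht.1)
  · simp [edgeWeights, Finset.sum_add_distrib]

lemma edgeWeights_left (h : i ≠ j) (t : ℝ) : edgeWeights i j t i = 1 - t := by
  simp [edgeWeights, h]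

lemma edgeWeights_right (h : i ≠ j) (t : ℝ) : edgeWeights i j t j = t := by
  simp [edgeWeights, h.symm]

lemma edgeWeights_of_ne {m : Fin n} (hi : m ≠ i) (hj : m ≠ j) (t : ℝ) :
    edgeWeights i j t m = 0 := by
  simp [edgeWeights, hi, hj]

lemma wsupp_edgeWeights_subset (t : ℝ) : wsupp (edgeWeights i j t) ⊆ {i, j} := by
  intro m hm
  by_contra h
  simp only [Finset.mem_insert, Finset.mem_singleton, not_or] at h
  exact mem_wsupp.1 hm (edgeWeights_of_ne h.1 h.2 t)

lemma wsupp_edgeWeights (h : i ≠ j) {t : ℝ} (ht : t ∈ Set.Ioo (0 : ℝ) 1) :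
    wsupp (edgeWeights i j t) = {i, j} := by
  refine (wsupp_edgeWeights_subset t).antisymm fun m hm => mem_wsupp.2 ?_
  simp only [Finset.mem_insert, Finset.mem_singleton] at hm
  rcases hm with rfl | rfl
  · rw [edgeWeights_left h]; linarith [ht.2]
  · rw [edgeWeights_right h]; exact ht.1.ne'

lemma eq_edgeWeights_of_wsupp_eq (h : i ≠ j) {u : Fin n → ℝ} (hu : u ∈ stdSimplex ℝ (Fin n))
    (hS : wsupp u = {i, j}) : u j ∈ Set.Ioo (0 : ℝ) 1 ∧ u = edgeWeights i j (u j) := by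
  have hs := sum_eq_one_of_wsupp_eq hS hu
  rw [Finset.sum_pair h] at hs
  have hi := pos_of_wsupp_eq hS hu (i := i) (by simp)
  have hj := pos_of_wsupp_eq hS hu (i := j) (by simp)
  refine ⟨⟨hj, by linarith⟩, ?_⟩
  funext m
  by_cases hmi : m = i
  · rw [hmi, edgeWeights_left h]; linarith
  by_cases hmj : m = j
  · rw [hmj, edgeWeights_right h]
  · rw [edgeWeights_of_ne hmi hmj, apply_eq_zero_of_wsupp_eq hS (by simp [hmi, hmj])]

lemma continuous_edgeWeights : Continuous (edgeWeights i j) := by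
  refine continuous_pi fun m => ?_
  simp only [edgeWeights, Pi.add_apply, Pi.single_apply]
  split_ifs <;> fun_prop

lemma triangleWeights_mem {p : ℝ × ℝ} (hp : p ∈ Set.Icc (0 : ℝ) 1 ×ˢ Set.Icc (0 : ℝ) 1) :
    triangleWeights i j k p ∈ stdSimplex ℝ (Fin n) := by
  obtain ⟨⟨h1, h2⟩, h3, h4⟩ := hp
  refine ⟨fun m => ?_, ?_⟩
  · exact add_nonneg (add_nonneg (single_apply_nonneg _ _ (sub_nonneg.2 h2))
      (single_apply_nonneg _ _ (mul_nonneg h1 (sub_nonneg.2 h4))))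
      (single_apply_nonneg _ _ (mul_nonneg h1 h3))
  · simp [triangleWeights, Finset.sum_add_distrib]
    ring

lemma triangleWeights_apply (hij : i ≠ j) (hik : i ≠ k) (hjk : j ≠ k) (p : ℝ × ℝ) :
    triangleWeights i j k p i = 1 - p.1 ∧ triangleWeights i j k p j = p.1 * (1 - p.2) ∧
      triangleWeights i j k p k = p.1 * p.2 := by
  simp [triangleWeights, hij, hik, hjk, hij.symm, hik.symm, hjk.symm]

lemma wsupp_triangleWeights_subset (p : ℝ × ℝ) : wsupp (triangleWeights i j k p) ⊆ {i, j, k} := by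
  intro m hm
  by_contra h
  simp only [Finset.mem_insert, Finset.mem_singleton, not_or] at h
  exact mem_wsupp.1 hm (by simp [triangleWeights, h])

lemma wsupp_triangleWeights_eq_iff (hij : i ≠ j) (hik : i ≠ k) (hjk : j ≠ k) (p : ℝ × ℝ) :
    wsupp (triangleWeights i j k p) = {i, j, k} ↔ p.1 ≠ 1 ∧ p.1 ≠ 0 ∧ p.2 ≠ 1 ∧ p.2 ≠ 0 := by
  obtain ⟨hi, hj, hk⟩ := triangleWeights_apply hij hik hjk p
  constructor
  · intro h
    have hi' : i ∈ wsupp (triangleWeights i j k p) := by simp [h]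
    have hj' : j ∈ wsupp (triangleWeights i j k p) := by simp [h]
    have hk' : k ∈ wsupp (triangleWeights i j k p) := by simp [h]
    rw [mem_wsupp, hi] at hi'
    rw [mem_wsupp, hj] at hj'
    rw [mem_wsupp, hk] at hk'
    refine ⟨fun h => hi' (by rw [h, sub_self]), left_ne_zero_of_mul hj',
      fun h => hj' (by rw [h, sub_self, mul_zero]), right_ne_zero_of_mul hk'⟩
  · rintro ⟨h1, h2, h3, h4⟩
    refine (wsupp_triangleWeights_subset p).antisymm fun m hm => mem_wsupp.2 ?_
    simp only [Finset.mem_insert, Finset.mem_singleton] at hm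
    rcases hm with rfl | rfl | rfl
    · rw [hi]; exact sub_ne_zero.2 h1.symm
    · rw [hj]; exact mul_ne_zero h2 (sub_ne_zero.2 h3.symm)
    · rw [hk]; exact mul_ne_zero h2 h4

lemma exists_triangleWeights_of_wsupp_eq (hij : i ≠ j) (hik : i ≠ k) (hjk : j ≠ k)
    {u : Fin n → ℝ} (hu : u ∈ stdSimplex ℝ (Fin n)) (hS : wsupp u = {i, j, k}) :
    ∃ p ∈ Set.Ioo (0 : ℝ) 1 ×ˢ Set.Ioo (0 : ℝ) 1, u = triangleWeights i j k p := by
  have hs := sum_eq_one_of_wsupp_eq hS hu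
  rw [Finset.sum_insert (by simp [hij, hik]), Finset.sum_pair hjk] at hs
  have hi := pos_of_wsupp_eq hS hu (i := i) (by simp)
  have hj := pos_of_wsupp_eq hS hu (i := j) (by simp)
  have hk := pos_of_wsupp_eq hS hu (i := k) (by simp)
  have hjk0 : 0 < u j + u k := add_pos hj hk
  refine ⟨(u j + u k, u k / (u j + u k)), ⟨⟨hjk0, ?_⟩, div_pos hk hjk0, ?_⟩, ?_⟩
  · dsimp only; linarith
  · rw [div_lt_one hjk0]; linarith
  · obtain ⟨ei, ej, ek⟩ := triangleWeights_apply hij hik hjk (u j + u k, u k / (u j + u k))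
    funext m
    by_cases hmi : m = i
    · rw [hmi, ei]; linarith
    by_cases hmj : m = j
    · rw [hmj, ej]; field_simp; ring
    by_cases hmk : m = k
    · rw [hmk, ek]; field_simp
    · rw [apply_eq_zero_of_wsupp_eq hS (by simp [hmi, hmj, hmk])]
      simp [triangleWeights, hmi, hmj, hmk]

lemma continuous_triangleWeights : Continuous (triangleWeights i j k) := by
  refine continuous_pi fun m => ?_
  simp only [triangleWeights, Pi.add_apply, Pi.single_apply]
  split_ifs <;> fun_prop

end Weights

namespace CameraConfig

variable {n : ℕ} {K : CameraConfig n} {i j k : Fin n}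

lemma stratumStep_one (K : CameraConfig n) : StratumStep (Dinf K.A K.Cs) 1 4 := by
  intro S 𝒮 c hS hS𝒮 _ hc
  obtain ⟨i, rfl⟩ := Finset.card_eq_one.1 hS
  have key := hc.attach_ruled (fun w st => (K.theta i w st, (Pi.single i 1 : Fin n → ℝ))) ?_ ?_ ?_
  · convert key using 1
    rw [strata_insert]
    congr 1
    ext ⟨P, u⟩
    simp only [Set.mem_ofPred_eq, Finset.mem_singleton, forall_eq]
    constructor
    · rintro ⟨hu, hwu, hP⟩
      obtain ⟨x, w, hV, rfl⟩ := mem_Dinf_iff.1 hP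
      obtain ⟨v, st, hv, hst, e⟩ := exists_theta_eq hV
      refine ⟨v, st, fun h => by simp [h] at hv, fun h => by simp [h] at hst, ?_⟩
      rw [e, eq_single_of_wsupp_eq hu hwu]
    · rintro ⟨w, st, hw, hst, e⟩
      obtain ⟨rfl, rfl⟩ := Prod.mk.inj e
      exact ⟨single_mem_stdSimplex ℝ i, wsupp_single i,
        mem_Dinf_iff.2 ⟨_, _, valid_theta hw hst, rfl⟩⟩
  · rintro ⟨w, st⟩ ⟨hw, hst⟩
    refine ContinuousAt.continuousWithinAt (ContinuousAt.prodMk ?_ continuousAt_const)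
    exact continuousAt_pt (f := fun q : (Fin 2 → ℂ) × (Fin 2 → ℂ) => K.planePt i q.1 q.2)
      (g := fun q => K.planeParam i q.1) continuous_planePt.continuousAt
      (continuous_planeParam.comp continuous_fst).continuousAt (valid_theta hw hst)
  · exact fun w st _ _ => notMem_strata hS𝒮 (wsupp_single i)
  · intro w st w' st' hw hst hw' hst'
    rw [← theta_eq_iff (K := K) (i := i) hw hst hw' hst']
    simp

/-- On the intersection of two divisors, a point is determined by a point of space. -/
lemma exists_of_mem_Dinf_inter (hij : i ≠ j) {P : Fin n → P2} (hi : P ∈ Dinf K.A K.Cs i)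
    (hj : P ∈ Dinf K.A K.Cs j) : ∃ x, x ≠ 0 ∧ K.l i x = 0 ∧ K.l j x = 0 ∧ P = K.pt i x x := by
  obtain ⟨x, w, hV, rfl⟩ := mem_Dinf_iff.1 hi
  have hl := hV.pt_mem_Dinf.1 hj
  exact ⟨x, hV.ne, hV.lx, hl, hV.pt_eq_self fun h0 => hV.ne (eq_zero_of_mulVec hl hij h0)⟩

lemma valid_of_inter (hij : i ≠ j) {x : Fin 4 → ℂ} (hx : x ≠ 0) (hi : K.l i x = 0)
    (hj : K.l j x = 0) : K.Valid i x x :=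
  valid_self hi fun h0 => hx (eq_zero_of_mulVec hj hij h0)

lemma stratumStep_two (K : CameraConfig n) : StratumStep (Dinf K.A K.Cs) 2 (-2) := by
  intro S 𝒮 c hS hS𝒮 h𝒮 hc
  obtain ⟨i, j, hij, rfl⟩ := Finset.card_eq_two.1 hS
  obtain ⟨B, hB, hBl⟩ := K.exists_line_param hij
  have hBne : ∀ w, w ≠ 0 → B w ≠ 0 := fun w hw h0 => hw (hB (h0.trans (map_zero B).symm))
  have hBi : ∀ w, K.l i (B w) = 0 := fun w => ((hBl _).2 ⟨w, rfl⟩).1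
  have hBj : ∀ w, K.l j (B w) = 0 := fun w => ((hBl _).2 ⟨w, rfl⟩).2
  have hV : ∀ w, w ≠ 0 → K.Valid i (B w) (B w) := fun w hw =>
    valid_of_inter hij (hBne w hw) (hBi w) (hBj w)
  have hmem : ∀ w, w ≠ 0 → ∀ m ∈ ({i, j} : Finset (Fin n)),
      K.pt i (B w) (B w) ∈ Dinf K.A K.Cs m := by
    intro w hw m hm
    rw [(hV w hw).pt_mem_Dinf]
    simp only [Finset.mem_insert, Finset.mem_singleton] at hm
    rcases hm with rfl | rfl
    exacts [hBi w, hBj w]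
  have key := hc.attach_line_prod (fun w t => (K.pt i (B w) (B w), edgeWeights i j t)) ?_ ?_ ?_ ?_
  · convert key using 1
    rw [strata_insert]
    congr 1
    ext ⟨P, u⟩
    simp only [Set.mem_ofPred_eq]
    constructor
    · rintro ⟨hu, hwu, hP⟩
      obtain ⟨x, hx, hi, hj, rfl⟩ := exists_of_mem_Dinf_inter hij (hP i (by simp)) (hP j (by simp))
      obtain ⟨w, rfl⟩ := (hBl x).1 ⟨hi, hj⟩
      obtain ⟨h1, h2⟩ := eq_edgeWeights_of_wsupp_eq hij hu hwu
      exact ⟨w, fun h => hx (by simp [h]), _, h1, Prod.ext rfl h2⟩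
    · rintro ⟨w, hw, t, ht, e⟩
      obtain ⟨rfl, rfl⟩ := Prod.mk.inj e
      exact ⟨edgeWeights_mem (Set.Ioo_subset_Icc_self ht), wsupp_edgeWeights hij ht, hmem w hw⟩
  · rintro ⟨w, t⟩ hw
    refine ContinuousAt.continuousWithinAt (ContinuousAt.prodMk ?_ ?_)
    · have hcB : Continuous fun q : (Fin 2 → ℂ) × ℝ => B q.1 :=
        (LinearMap.continuous_of_finiteDimensional B).comp continuous_fst
      exact continuousAt_pt hcB.continuousAt hcB.continuousAt (hV w hw)
    · exact (continuous_edgeWeights.comp continuous_snd).continuousAt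
  · intro w hw
    have hbd : ∀ t ∈ Set.Icc (0 : ℝ) 1, ∀ m ∈ ({i, j} : Finset (Fin n)), edgeWeights i j t m = 0 →
        (K.pt i (B w) (B w), edgeWeights i j t) ∈ strata (Dinf K.A K.Cs) 𝒮 := by
      intro t ht m hm h0
      refine mem_strata_of_ssubset h𝒮 (hmem w hw) (edgeWeights_mem ht)
        ((Finset.ssubset_iff_of_subset (wsupp_edgeWeights_subset t)).2 ⟨m, hm, ?_⟩)
      simp [h0]
    exact ⟨hbd 0 (by simp) j (by simp) (edgeWeights_right hij 0),
      hbd 1 (by simp) i (by simp) (by rw [edgeWeights_left hij, sub_self])⟩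
  · exact fun w hw t ht => notMem_strata hS𝒮 (wsupp_edgeWeights hij ht)
  · intro w w' t t' hw hw'
    rw [Prod.mk.injEq]
    refine and_congr ?_ ⟨fun h => ?_, fun h => h ▸ rfl⟩
    · constructor
      · intro h
        obtain ⟨μ, hμ, e⟩ := exists_smul_of_pt_eq (hV w hw) (hV w' hw') h
        exact ⟨μ, hμ, hB (by rw [e, map_smul])⟩
      · rintro ⟨ν, hν, rfl⟩
        funext m
        simp [pt, Matrix.mulVec_smul, mkP_smul hν]
    · have := congrFun h j
      rwa [edgeWeights_right hij, edgeWeights_right hij] at this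

lemma stratumStep_three (K : CameraConfig n) : StratumStep (Dinf K.A K.Cs) 3 1 := by
  intro S 𝒮 c hS hS𝒮 h𝒮 hc
  obtain ⟨i, j, k, hij, hik, hjk, rfl⟩ := Finset.card_eq_three.1 hS
  obtain ⟨x, hx, hxl⟩ := K.exists_triple_point hij hik hjk
  obtain ⟨hi, hj, hk⟩ := (hxl x).2 ⟨1, (one_smul ℂ x).symm⟩
  have hV := valid_of_inter hij hx hi hj
  have hmem : ∀ m ∈ ({i, j, k} : Finset (Fin n)), K.pt i x x ∈ Dinf K.A K.Cs m := by
    intro m hm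
    rw [hV.pt_mem_Dinf]
    simp only [Finset.mem_insert, Finset.mem_singleton] at hm
    rcases hm with rfl | rfl | rfl
    exacts [hi, hj, hk]
  have hint : ∀ p ∈ Set.Ioo (0 : ℝ) 1 ×ˢ Set.Ioo (0 : ℝ) 1,
      wsupp (triangleWeights i j k p) = {i, j, k} := fun p hp =>
    (wsupp_triangleWeights_eq_iff hij hik hjk p).2
      ⟨hp.1.2.ne, hp.1.1.ne', hp.2.2.ne, hp.2.1.ne'⟩
  have hsub : Set.Ioo (0 : ℝ) 1 ×ˢ Set.Ioo (0 : ℝ) 1 ⊆ Set.Icc (0 : ℝ) 1 ×ˢ Set.Icc (0 : ℝ) 1 :=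
    Set.prod_mono Set.Ioo_subset_Icc_self Set.Ioo_subset_Icc_self
  have key := hc.attach_square (fun p => (K.pt i x x, triangleWeights i j k p)) ?_ ?_ ?_ ?_
  · convert key using 1
    rw [strata_insert]
    congr 1
    ext ⟨P, u⟩
    simp only [Set.mem_ofPred_eq]
    constructor
    · rintro ⟨hu, hwu, hP⟩
      obtain ⟨y, hy, hyi, hyj, rfl⟩ :=
        exists_of_mem_Dinf_inter hij (hP i (by simp)) (hP j (by simp))
      have hyk := (valid_of_inter hij hy hyi hyj).pt_mem_Dinf.1 (hP k (by simp))
      obtain ⟨a, rfl⟩ := (hxl y).1 ⟨hyi, hyj, hyk⟩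
      have ha : a ≠ 0 := fun h => hy (by simp [h])
      obtain ⟨p, hp, rfl⟩ := exists_triangleWeights_of_wsupp_eq hij hik hjk hu hwu
      refine ⟨p, hp, Prod.ext (funext fun m => ?_) rfl⟩
      simp [pt, Matrix.mulVec_smul, mkP_smul ha]
    · rintro ⟨p, hp, e⟩
      obtain ⟨rfl, rfl⟩ := Prod.mk.inj e
      exact ⟨triangleWeights_mem (hsub hp), hint p hp, hmem⟩
  · exact continuous_const.prodMk continuous_triangleWeights
  · intro p hp hp'
    refine mem_strata_of_ssubset h𝒮 hmem (triangleWeights_mem hp)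
      ((wsupp_triangleWeights_subset p).ssubset_of_ne fun h => hp' ?_)
    obtain ⟨h1, h2, h3, h4⟩ := (wsupp_triangleWeights_eq_iff hij hik hjk p).1 h
    exact ⟨⟨hp.1.1.lt_of_ne' h2, hp.1.2.lt_of_ne h1⟩, hp.2.1.lt_of_ne' h4, hp.2.2.lt_of_ne h3⟩
  · rintro ⟨a, b⟩ hp ⟨a', b'⟩ - h
    have h := (Prod.mk.inj h).2
    obtain ⟨h1, -, h3⟩ := triangleWeights_apply hij hik hjk (a, b)
    obtain ⟨h1', -, h3'⟩ := triangleWeights_apply hij hik hjk (a', b')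
    rw [h] at h1 h3
    rw [h1] at h1'
    rw [h3] at h3'
    have ha : a = a' := by simpa using h1'
    subst ha
    rw [mul_right_inj' hp.1.1.ne'] at h3'
    exact Prod.ext rfl h3'
  · exact fun p hp => notMem_strata hS𝒮 (hint p hp)

lemma card_wsupp_lt_four (K : CameraConfig n) {p : (Fin n → P2) × (Fin n → ℝ)}
    (hp : p ∈ blowupUnion (Dinf K.A K.Cs)) : (wsupp p.2).card < 4 := by
  by_contra! h
  obtain ⟨T, hT, hT4⟩ := Finset.exists_subset_card_eq h
  let e : Fin 4 ≃ T := (Finset.equivFinOfCardEq hT4).symm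
  have hinj : Function.Injective fun a => (e a : Fin n) := Subtype.val_injective.comp e.injective
  have hm : ∀ a, p.1 ∈ Dinf K.A K.Cs (e a) := fun a => hp.2 _ (mem_wsupp.1 (hT (e a).2))
  obtain ⟨x, w, hV, hx⟩ := mem_Dinf_iff.1 (hm 0)
  refine hV.ne (K.injective_of_card_four hinj ?_)
  rw [map_zero]
  funext a
  have := hm a
  rw [hx, hV.pt_mem_Dinf] at this
  exact this

/-- The Euler characteristic of the divisor at infinity of cameras in general position. -/
lemma hasEulerChar_DinfAll (K : CameraConfig n) : ∃ e : ℤ, HasEulerChar ↥(DinfAll K.A K.Cs) e ∧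
    6 * e = (n : ℤ) ^ 3 - 9 * (n : ℤ) ^ 2 + 32 * (n : ℤ) := by
  refine ⟨n * 4 + n.choose 2 * (-2) + n.choose 3 * 1, ?_, ?_⟩
  · rw [DinfAll_eq]
    exact HasEulerChar.of_blowupUnion (cellBuilt_blowupUnion K.stratumStep_one K.stratumStep_two
      K.stratumStep_three fun p hp => K.card_wsupp_lt_four hp) K.homotopyEquiv_divisor
  · obtain ⟨m, rfl⟩ := Nat.exists_eq_add_of_le' K.three_le
    have e2 : (2 : ℤ) * ((m + 3).choose 2 : ℤ) = (m + 3) * (m + 2) := by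
      have := Nat.descFactorial_eq_factorial_mul_choose (m + 3) 2
      simp [Nat.descFactorial, Nat.factorial] at this
      zify at this
      linarith
    have e3 : (6 : ℤ) * ((m + 3).choose 3 : ℤ) = (m + 3) * (m + 2) * (m + 1) := by
      have := Nat.descFactorial_eq_factorial_mul_choose (m + 3) 3
      simp [Nat.descFactorial, Nat.factorial] at this
      zify at this
      linarith
    push_cast
    linear_combination (-6) * e2 + e3

end CameraConfig

/-! Cameras and charts with general parameters are in general position. -/

section Generic

variable {σ : Type} {P Q : (σ → ℂ) → Prop}

lemma Generically.mono (h : Generically P) (hPQ : ∀ a, P a → Q a) : Generically Q := by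
  obtain ⟨q, hq, h⟩ := h
  exact ⟨q, hq, fun a ha => hPQ a (h a ha)⟩

lemma Generically.and (hP : Generically P) (hQ : Generically Q) :
    Generically fun a => P a ∧ Q a := by
  obtain ⟨p, hp, hP⟩ := hP
  obtain ⟨q, hq, hQ⟩ := hQ
  refine ⟨p * q, mul_ne_zero hp hq, fun a ha => ?_⟩
  rw [map_mul] at ha
  exact ⟨hP a (left_ne_zero_of_mul ha), hQ a (right_ne_zero_of_mul ha)⟩

lemma generically_forall {ι : Type*} [Finite ι] {P : ι → (σ → ℂ) → Prop}
    (h : ∀ i, Generically (P i)) : Generically fun a => ∀ i, P i a := by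
  have := Fintype.ofFinite ι
  choose q hq h using h
  refine ⟨∏ i, q i, Finset.prod_ne_zero_iff.2 fun i _ => hq i, fun a ha i => h i a ?_⟩
  rw [map_prod, Finset.prod_ne_zero_iff] at ha
  exact ha i (Finset.mem_univ i)

lemma generically_of_forall (h : ∀ a, P a) : Generically P := ⟨1, one_ne_zero, fun a _ => h a⟩

/-- The algebra of polynomial functions. -/
def polyFun (σ : Type) : Subalgebra ℂ ((σ → ℂ) → ℂ) :=
  (AlgHom.pi fun a : σ → ℂ => MvPolynomial.aeval a :
    MvPolynomial σ ℂ →ₐ[ℂ] ((σ → ℂ) → ℂ)).range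

lemma coord_mem_polyFun (s : σ) : (fun a : σ → ℂ => a s) ∈ polyFun σ :=
  ⟨MvPolynomial.X s, by ext a; simp⟩

lemma const_mem_polyFun (z : ℂ) : (fun _ : σ → ℂ => z) ∈ polyFun σ :=
  (polyFun σ).algebraMap_mem z

lemma det_mem_polyFun {m : ℕ} {M : (σ → ℂ) → Matrix (Fin m) (Fin m) ℂ}
    (h : ∀ r c, (fun a => M a r c) ∈ polyFun σ) : (fun a => (M a).det) ∈ polyFun σ := by
  have : (fun a => (M a).det) = ∑ τ : Equiv.Perm (Fin m),
      (fun _ => ((Equiv.Perm.sign τ : ℤ) : ℂ)) * ∏ r, fun a => M a (τ r) r := by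
    ext a
    simp [Matrix.det_apply']
  rw [this]
  exact sum_mem fun τ _ => mul_mem (const_mem_polyFun _) (prod_mem fun r _ => h _ _)

lemma adjugate_mem_polyFun {m : ℕ} {M : (σ → ℂ) → Matrix (Fin m) (Fin m) ℂ}
    (h : ∀ r c, (fun a => M a r c) ∈ polyFun σ) (r c : Fin m) :
    (fun a => (M a).adjugate r c) ∈ polyFun σ := by
  simp only [Matrix.adjugate_apply]
  refine det_mem_polyFun fun r' c' => ?_
  by_cases hr : r' = c
  · simpa [Matrix.updateRow_apply, hr] using const_mem_polyFun _
  · simpa [Matrix.updateRow_apply, hr] using h r' c'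

lemma generically_of_polyFun {f : (σ → ℂ) → ℂ} (hf : f ∈ polyFun σ) {a₀ : σ → ℂ} (h₀ : f a₀ ≠ 0)
    (h : ∀ a, f a ≠ 0 → P a) : Generically P := by
  obtain ⟨q, rfl⟩ := hf
  refine ⟨q, ?_, fun a ha => h a ?_⟩
  · rintro rfl
    simp at h₀
  · simpa [MvPolynomial.aeval_eq_eval] using ha

/-- Independence at one parameter implies independence at general parameters. -/
lemma generically_linearIndependent {m : ℕ} {l : (σ → ℂ) → Fin m → (Fin 4 → ℂ) →ₗ[ℂ] ℂ}
    (hl : ∀ k x, (fun a => l a k x) ∈ polyFun σ) {a₀ : σ → ℂ}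
    (h₀ : LinearIndependent ℂ (l a₀)) : Generically fun a => LinearIndependent ℂ (l a) := by
  choose v hv using fun k : Fin m =>
    pi_surjective_of_linearIndependent h₀ (Pi.single k 1 : Fin m → ℂ)
  refine generically_of_polyFun (f := fun a => (Matrix.of fun r k => l a r (v k)).det)
    (det_mem_polyFun fun r k => hl r (v k)) (a₀ := a₀) ?_ fun a ha => ?_
  · have : (Matrix.of fun r k => l a₀ r (v k)) = 1 := by
      ext r k
      simpa [Pi.single_apply, Matrix.one_apply] using congrFun (hv k) r
    simp [this]
  · rw [Fintype.linearIndependent_iff]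
    intro g hg
    refine congrFun (Matrix.eq_zero_of_vecMul_eq_zero ha (v := g) ?_)
    ext k
    simpa [Matrix.vecMul, dotProduct] using LinearMap.congr_fun hg (v k)

end Generic

/-- The linear form cutting out the preimage under a camera of the line at infinity of a chart. -/
def infForm (A : Matrix (Fin 3) (Fin 4) ℂ) (C : Matrix (Fin 3) (Fin 3) ℂ) :
    (Fin 4 → ℂ) →ₗ[ℂ] ℂ :=
  LinearMap.proj 0 ∘ₗ C.adjugate.mulVecLin ∘ₗ A.mulVecLin

lemma infForm_apply (A : Matrix (Fin 3) (Fin 4) ℂ) (C : Matrix (Fin 3) (Fin 3) ℂ)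
    (x : Fin 4 → ℂ) : infForm A C x = C.adjugate.mulVec (A.mulVec x) 0 := rfl

lemma mkP_mem_infLine_iff {C : Matrix (Fin 3) (Fin 3) ℂ} (hC : C.det ≠ 0) {v : Fin 3 → ℂ}
    (hv : v ≠ 0) : mkP v ∈ infLine C ↔ C.adjugate.mulVec v 0 = 0 := by
  constructor
  · rintro ⟨w, hw, hw0, h⟩
    have hCw : C.mulVec w ≠ 0 := fun h0 => hw (Matrix.eq_zero_of_mulVec_eq_zero hC h0)
    obtain ⟨μ, hμ⟩ := (mkP_eq_iff hv hCw).1 h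
    have hμ0 : μ ≠ 0 := fun h0 => hCw (by rw [hμ, h0, zero_smul])
    have := congrFun (congrArg C.adjugate.mulVec hμ) 0
    rw [Matrix.mulVec_mulVec, Matrix.adjugate_mul, Matrix.smul_mulVec, Matrix.one_mulVec,
      Matrix.mulVec_smul, Pi.smul_apply, Pi.smul_apply, hw0, smul_zero] at this
    simpa [hμ0] using this.symm
  · intro h
    have key : C.mulVec (C.adjugate.mulVec v) = C.det • v := by
      rw [Matrix.mulVec_mulVec, Matrix.mul_adjugate, Matrix.smul_mulVec, Matrix.one_mulVec]
    refine ⟨_, fun h0 => ?_, h, ?_⟩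
    · rw [h0, Matrix.mulVec_zero] at key
      exact smul_ne_zero hC hv key.symm
    · rw [key, mkP_smul hC]

lemma exists_adjugate_row (u : Fin 3 → ℂ) : ∃ C : Matrix (Fin 3) (Fin 3) ℂ, C.adjugate 0 = u := by
  have key : ∀ p q : Fin 3 → ℂ, p 1 * q 2 - p 2 * q 1 = u 0 → p 2 * q 0 - p 0 * q 2 = u 1 →
      p 0 * q 1 - p 1 * q 0 = u 2 → ∃ C : Matrix (Fin 3) (Fin 3) ℂ, C.adjugate 0 = u := by
    intro p q h0 h1 h2
    refine ⟨!![0, p 0, q 0; 0, p 1, q 1; 0, p 2, q 2], ?_⟩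
    ext k
    rw [Matrix.adjugate_fin_three]
    fin_cases k <;> simp
    exacts [by linear_combination h0, by linear_combination h1, by linear_combination h2]
  by_cases h0 : u 0 = 0
  · by_cases h1 : u 1 = 0
    · by_cases h2 : u 2 = 0
      · exact key 0 0 (by simp [h0]) (by simp [h1]) (by simp [h2])
      · refine key ![u 2, 0, -u 0] ![0, 1, -u 1 / u 2] ?_ ?_ ?_ <;> simp <;> field_simp
    · refine key ![0, -u 2, u 1] ![1, -u 0 / u 1, 0] ?_ ?_ ?_ <;> simp <;> field_simp
  · refine key ![-u 1, u 0, 0] ![-u 2 / u 0, 0, 1] ?_ ?_ ?_ <;> simp <;> field_simp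

/-- Every form vanishing on the kernel of a camera comes from some chart. -/
lemma exists_infForm_eq {A : Matrix (Fin 3) (Fin 4) ℂ} (hA : ∀ v, ∃ x, A.mulVec x = v)
    (φ : (Fin 4 → ℂ) →ₗ[ℂ] ℂ) (hφ : ∀ x, A.mulVec x = 0 → φ x = 0) : ∃ C, infForm A C = φ := by
  choose s hs using fun r : Fin 3 => hA (Pi.single r 1)
  obtain ⟨C, hC⟩ := exists_adjugate_row fun r => φ (s r)
  refine ⟨C, LinearMap.ext fun x => ?_⟩
  have h0 : A.mulVec (x - ∑ r, A.mulVec x r • s r) = 0 := by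
    rw [Matrix.mulVec_sub, Matrix.mulVec_sum]
    simp only [Matrix.mulVec_smul, hs]
    rw [sub_eq_zero]
    exact pi_eq_sum_univ' _
  have h1 := hφ _ h0
  rw [map_sub, map_sum, sub_eq_zero] at h1
  rw [infForm_apply, h1]
  simp [Matrix.mulVec, dotProduct, hC, mul_comm]

section Independent

variable {k : ℕ}

lemma three_le_finrank_vanishing (c : Fin 4 → ℂ) : 3 ≤ Module.finrank ℂ
    ↥(LinearMap.ker (LinearMap.applyₗ c : ((Fin 4 → ℂ) →ₗ[ℂ] ℂ) →ₗ[ℂ] ℂ)) := by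
  have h := LinearMap.finrank_range_add_finrank_ker
    (LinearMap.applyₗ c : ((Fin 4 → ℂ) →ₗ[ℂ] ℂ) →ₗ[ℂ] ℂ)
  have h1 := (LinearMap.range (LinearMap.applyₗ c : ((Fin 4 → ℂ) →ₗ[ℂ] ℂ) →ₗ[ℂ] ℂ)).finrank_le
  have h4 : Module.finrank ℂ ((Fin 4 → ℂ) →ₗ[ℂ] ℂ) = 4 := by
    rw [Module.finrank_linearMap]; simp
  rw [Module.finrank_self] at h1
  omega

/-- Independent forms can be extended by a form vanishing at a given point. -/
lemma exists_cons_independent {l : Fin k → (Fin 4 → ℂ) →ₗ[ℂ] ℂ} (hl : LinearIndependent ℂ l)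
    (c : Fin 4 → ℂ) (hk : k ≤ 2 ∨ k = 3 ∧ ∃ r, l r c ≠ 0) :
    ∃ φ : (Fin 4 → ℂ) →ₗ[ℂ] ℂ, φ c = 0 ∧
      LinearIndependent ℂ (Fin.cons φ l : Fin (k + 1) → (Fin 4 → ℂ) →ₗ[ℂ] ℂ) := by
  by_contra! h
  have hle : LinearMap.ker (LinearMap.applyₗ c : ((Fin 4 → ℂ) →ₗ[ℂ] ℂ) →ₗ[ℂ] ℂ) ≤
      Submodule.span ℂ (Set.range l) := by
    intro φ hφ
    by_contra hs
    exact h φ hφ (linearIndependent_finCons.2 ⟨hl, hs⟩)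
  have h3 := three_le_finrank_vanishing c
  have hspan := finrank_span_eq_card hl
  rw [Fintype.card_fin] at hspan
  rcases hk with hk | ⟨rfl, r, hr⟩
  · have := Submodule.finrank_mono hle
    omega
  · have heq := Submodule.eq_of_le_of_finrank_le hle (by omega)
    have : l r ∈ Submodule.span ℂ (Set.range l) := Submodule.subset_span ⟨r, rfl⟩
    rw [← heq] at this
    exact hr this

/-- There are independent forms vanishing at four given points, if some form separates the first
from the last. -/
lemma exists_independent_forms (c : Fin 4 → Fin 4 → ℂ) {φ : (Fin 4 → ℂ) →ₗ[ℂ] ℂ}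
    (h0 : φ (c 0) = 0) (h3 : φ (c 3) ≠ 0) :
    ∃ l : Fin 4 → (Fin 4 → ℂ) →ₗ[ℂ] ℂ, LinearIndependent ℂ l ∧ ∀ r, l r (c r) = 0 := by
  have hφ : φ ≠ 0 := fun h => h3 (by simp [h])
  have i1 : LinearIndependent ℂ ![φ] := linearIndependent_unique_iff.2 hφ
  obtain ⟨φ₁, e1, i2⟩ := exists_cons_independent i1 (c 1) (by norm_num)
  obtain ⟨φ₂, e2, i3⟩ := exists_cons_independent i2 (c 2) (by norm_num)
  obtain ⟨φ₃, e3, i4⟩ := exists_cons_independent i3 (c 3) (Or.inr ⟨rfl, 2, h3⟩)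
  refine ⟨_, i4.comp Fin.rev Fin.rev_injective, fun r => ?_⟩
  fin_cases r
  exacts [h0, e1, e2, e3]

end Independent

section Rank

variable {A : Matrix (Fin 3) (Fin 4) ℂ}

lemma mulVec_surjective_of_rank (hA : A.rank = 3) (v : Fin 3 → ℂ) : ∃ x, A.mulVec x = v := by
  have h : LinearMap.range A.mulVecLin = ⊤ :=
    Submodule.eq_top_of_finrank_eq (by rw [Module.finrank_fin_fun]; exact hA)
  exact LinearMap.range_eq_top.1 h v

lemma exists_centre_of_rank (hA : A.rank = 3) :
    ∃ c : Fin 4 → ℂ, c ≠ 0 ∧ ∀ x, A.mulVec x = 0 ↔ ∃ a : ℂ, x = a • c := by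
  have h := LinearMap.finrank_range_add_finrank_ker A.mulVecLin
  rw [Module.finrank_fin_fun] at h
  have h1 : Module.finrank ℂ ↥(LinearMap.ker A.mulVecLin) = 1 := by
    have : Module.finrank ℂ ↥(LinearMap.range A.mulVecLin) = 3 := hA
    omega
  obtain ⟨c, hc, hspan⟩ := finrank_eq_one_iff'.1 h1
  refine ⟨c, fun h0 => hc (Subtype.ext h0), fun x => ⟨fun hx => ?_, ?_⟩⟩
  · obtain ⟨a, ha⟩ := hspan ⟨x, hx⟩
    exact ⟨a, by rw [← Submodule.coe_smul, ha]⟩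
  · rintro ⟨a, rfl⟩
    have : A.mulVec c = 0 := c.2
    rw [Matrix.mulVec_smul, this, smul_zero]

end Rank

variable {n : ℕ}

/-- General cameras have distinct centres. -/
lemma generically_centres_ne (n : ℕ) :
    Generically (K := ℂ) (σ := Fin n × Fin 3 × Fin 4) fun a => ∀ i j, i ≠ j → ∀ x : Fin 4 → ℂ,
      (camOfC a i).mulVec x = 0 → (camOfC a j).mulVec x = 0 → x = 0 := by
  refine generically_forall fun i => generically_forall fun j => ?_
  by_cases hij : i = j
  · exact generically_of_forall fun a h => absurd hij h
  let M : (Fin n × Fin 3 × Fin 4 → ℂ) → Matrix (Fin 4) (Fin 4) ℂ := fun a =>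
    Matrix.of (Fin.cons (camOfC a j 0) (camOfC a i))
  let a₀ : Fin n × Fin 3 × Fin 4 → ℂ := fun s =>
    if s.1 = i then (if s.2.2 = s.2.1.succ then 1 else 0) else if s.2.2 = 0 then 1 else 0
  refine generically_of_polyFun (f := fun a => (M a).det) (det_mem_polyFun fun r c => ?_)
    (a₀ := a₀) ?_ fun a ha _ x hi hj => ?_
  · refine Fin.cases ?_ (fun r => ?_) r
    · exact coord_mem_polyFun (j, 0, c)
    · exact coord_mem_polyFun (i, r, c)
  · have : M a₀ = 1 := by
      ext r c
      refine Fin.cases ?_ (fun r => ?_) r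
      · change a₀ (j, 0, c) = _
        simp [a₀, Ne.symm hij, Matrix.one_apply, eq_comm (a := c)]
      · change a₀ (i, r, c) = _
        simp [a₀, Matrix.one_apply, eq_comm]
    simp [this]
  · refine Matrix.eq_zero_of_mulVec_eq_zero ha (funext fun r => ?_)
    refine Fin.cases ?_ (fun r => ?_) r
    · exact congrFun hj 0
    · exact congrFun hi r

/-- Charts for which finitely many of the forms at infinity are prescribed. -/
lemma exists_charts {A : Fin n → Matrix (Fin 3) (Fin 4) ℂ}
    (hs : ∀ i v, ∃ x, (A i).mulVec x = v) {m : ℕ} {f : Fin m → Fin n}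
    (hf : Function.Injective f) (l : Fin m → (Fin 4 → ℂ) →ₗ[ℂ] ℂ)
    (hl : ∀ k x, (A (f k)).mulVec x = 0 → l k x = 0) :
    ∃ p : Fin n × Fin 3 × Fin 3 → ℂ, ∀ k, infForm (A (f k)) (chartOf p (f k)) = l k := by
  choose C hC using fun k => exists_infForm_eq (hs (f k)) (l k) (hl k)
  refine ⟨fun s => Function.extend f C 0 s.1 s.2.1 s.2.2, fun k => ?_⟩
  have : chartOf (fun s => Function.extend f C 0 s.1 s.2.1 s.2.2) (f k) = C k := by
    ext r c
    simp [chartOf, hf.extend_apply]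
  rw [this, hC]

lemma infForm_mem_polyFun (A : Matrix (Fin 3) (Fin 4) ℂ) (i : Fin n) (x : Fin 4 → ℂ) :
    (fun p => infForm A (chartOf p i) x) ∈ polyFun (Fin n × Fin 3 × Fin 3) := by
  have : (fun p => infForm A (chartOf p i) x) =
      ∑ r, (fun p => (chartOf p i).adjugate 0 r) * fun _ => A.mulVec x r := by
    ext p
    simp [infForm_apply, Matrix.mulVec, dotProduct]
  rw [this]
  exact sum_mem fun r _ => mul_mem
    (adjugate_mem_polyFun (fun r c => coord_mem_polyFun (i, r, c)) 0 r) (const_mem_polyFun _)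

lemma generically_infForm_independent {A : Fin n → Matrix (Fin 3) (Fin 4) ℂ}
    (hs : ∀ i v, ∃ x, (A i).mulVec x = v) {m : ℕ} {f : Fin m → Fin n}
    (hf : Function.Injective f) {l : Fin m → (Fin 4 → ℂ) →ₗ[ℂ] ℂ} (hl : LinearIndependent ℂ l)
    (hl0 : ∀ k x, (A (f k)).mulVec x = 0 → l k x = 0) :
    Generically fun p : Fin n × Fin 3 × Fin 3 → ℂ =>
      LinearIndependent ℂ ((fun i => infForm (A i) (chartOf p i)) ∘ f) := by
  obtain ⟨p₀, hp₀⟩ := exists_charts hs hf l hl0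
  refine generically_linearIndependent (fun k x => infForm_mem_polyFun (A (f k)) (f k) x)
    (a₀ := p₀) ?_
  convert hl using 1
  exact funext hp₀

/-- Cameras with distinct centres, together with general charts, are in general position. -/
lemma generically_cameraConfig (hn : 3 ≤ n) {A : Fin n → Matrix (Fin 3) (Fin 4) ℂ}
    (hA : ∀ i, (A i).rank = 3)
    (hne : ∀ i j, i ≠ j → ∀ x : Fin 4 → ℂ, (A i).mulVec x = 0 → (A j).mulVec x = 0 → x = 0) :
    Generically fun p : Fin n × Fin 3 × Fin 3 → ℂ => (∀ i, IsUnit (chartOf p i).det) →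
      ∃ K : CameraConfig n, K.A = A ∧ K.Cs = chartOf p := by
  have hs := fun i => mulVec_surjective_of_rank (hA i)
  choose c hc hker using fun i => exists_centre_of_rank (hA i)
  have hAc : ∀ i, (A i).mulVec (c i) = 0 := fun i => (hker i _).2 ⟨1, (one_smul ℂ _).symm⟩
  have hform : ∀ i j, i ≠ j →
      ∃ φ : (Fin 4 → ℂ) →ₗ[ℂ] ℂ, (∀ x, (A i).mulVec x = 0 → φ x = 0) ∧ φ (c j) ≠ 0 := by
    intro i j hij
    obtain ⟨r, hr⟩ : ∃ r, (A i).mulVec (c j) r ≠ 0 := by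
      by_contra! h
      exact hc j (hne i j hij _ (funext h) (hAc j))
    exact ⟨LinearMap.proj r ∘ₗ (A i).mulVecLin, fun x hx => congrFun hx r, hr⟩
  have hvan : ∀ i {φ : (Fin 4 → ℂ) →ₗ[ℂ] ℂ}, φ (c i) = 0 → ∀ x, (A i).mulVec x = 0 → φ x = 0 := by
    intro i φ h x hx
    obtain ⟨a, rfl⟩ := (hker i x).1 hx
    rw [map_smul, h, smul_zero]
  have g2 : Generically fun p : Fin n × Fin 3 × Fin 3 → ℂ => ∀ i j, i ≠ j →
      infForm (A i) (chartOf p i) (c j) ≠ 0 := by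
    refine generically_forall fun i => generically_forall fun j => ?_
    by_cases hij : i = j
    · exact generically_of_forall fun a h => absurd hij h
    obtain ⟨φ, hφ, hφj⟩ := hform i j hij
    obtain ⟨p₀, hp₀⟩ := exists_charts hs (f := fun _ : Fin 1 => i)
      (Function.injective_of_subsingleton _) (fun _ => φ) fun _ => hφ
    exact generically_of_polyFun (infForm_mem_polyFun (A i) i (c j)) (a₀ := p₀)
      (by rw [hp₀ 0]; exact hφj) fun _ h _ => h
  have g3 : Generically fun p : Fin n × Fin 3 × Fin 3 → ℂ => ∀ f : Fin 3 → Fin n,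
      Function.Injective f →
        LinearIndependent ℂ ((fun i => infForm (A i) (chartOf p i)) ∘ f) := by
    refine generically_forall fun f => ?_
    by_cases hf : Function.Injective f
    · obtain ⟨φ, hφ, hφ1⟩ := hform (f 0) (f 1) (hf.ne (by decide))
      obtain ⟨l, hl, hl0⟩ := exists_independent_forms
        ![c (f 0), c (f 1), c (f 2), c (f 1)] (hφ _ (hAc _)) hφ1
      refine (generically_infForm_independent hs hf (hl.comp Fin.castSucc
        (Fin.castSucc_injective 3)) fun k => hvan (f k) ?_).mono fun _ h _ => h
      have := hl0 k.castSucc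
      fin_cases k <;> exact this
    · exact generically_of_forall fun a h => absurd h hf
  have g4 : Generically fun p : Fin n × Fin 3 × Fin 3 → ℂ => ∀ f : Fin 4 → Fin n,
      Function.Injective f →
        LinearIndependent ℂ ((fun i => infForm (A i) (chartOf p i)) ∘ f) := by
    refine generically_forall fun f => ?_
    by_cases hf : Function.Injective f
    · obtain ⟨φ, hφ, hφ3⟩ := hform (f 0) (f 3) (hf.ne (by decide))
      obtain ⟨l, hl, hl0⟩ := exists_independent_forms (fun k => c (f k)) (hφ _ (hAc _)) hφ3
      exact (generically_infForm_independent hs hf hl fun k => hvan (f k) (hl0 k)).mono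
        fun _ h _ => h
    · exact generically_of_forall fun a h => absurd h hf
  refine ((g2.and g3).and g4).mono fun p hp hdet => ?_
  obtain ⟨⟨h2, h3⟩, h4⟩ := hp
  exact ⟨{
    A := A
    Cs := chartOf p
    c := c
    l := fun i => infForm (A i) (chartOf p i)
    three_le := hn
    c_ne := hc
    mulVec_eq_zero := hker
    surj := hs
    l_c := fun i => by rw [infForm_apply, hAc, Matrix.mulVec_zero, Pi.zero_apply]
    l_c_ne := h2
    ind3 := h3
    ind4 := h4
    inf_iff := fun i x hx => mkP_mem_infLine_iff (hdet i).ne_zero hx }, rfl, rfl⟩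

/-- **Theorem 4.2 (3).** For `n ≥ 3` general cameras and general affine charts, the
divisor at infinity `D_∞ = Yₙ ∩ H_∞` satisfies
`χ(D_∞) = n³/6 - 3n²/2 + 16n/3`, i.e. `6 χ(D_∞) = n³ - 9n² + 32n`. -/
theorem chi_divisor_at_infinity (n : ℕ) (hn : 3 ≤ n) :
    Generically (K := ℂ) (σ := Fin n × Fin 3 × Fin 4) fun a =>
      (∀ i, (camOfC a i).rank = 3) →
      Generically (K := ℂ) (σ := Fin n × Fin 3 × Fin 3) fun cpar =>
        (∀ i, IsUnit (chartOf cpar i).det) →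
        ∃ e : ℤ, HasEulerChar ↥(DinfAll (camOfC a) (chartOf cpar)) e ∧
          6 * e = (n : ℤ) ^ 3 - 9 * (n : ℤ) ^ 2 + 32 * (n : ℤ) := by
  refine (generically_centres_ne n).mono fun a ha hrank => ?_
  refine (generically_cameraConfig hn hrank ha).mono fun cpar h hdet => ?_
  obtain ⟨K, hA, hC⟩ := h hdet
  rw [← hA, ← hC]
  exact K.hasEulerChar_DinfAll

end PaperED
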